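/- There is a positive real constant C such that for every natural number n ≥ 2 there exist a natural number r and a simple graph G on n vertices which is triangle-free (contains no clique on 3 vertices), is r-regular (every vertex has degree r), and whose independence number satisfies α(G) ≤ C·√(n·log n). -/

import Mathlib

namespace RTF
open Finset
open scoped Classical

noncomputable section

/-- uniform probability on a finite type -/
def Pr {Ω : Type*} [Fintype Ω] (P : Ω → Prop) : ℝ :=
  ((univ.filter P).card : ℝ) / Fintype.card Ω

/-- uniform expectation on a finite type -/
def Ex {Ω : Type*} [Fintype Ω] (f : Ω → ℝ) : ℝ := (∑ ω, f ω) / Fintype.card Ω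

section prob
variable {Ω : Type*} [Fintype Ω]

lemma Pr_mono {P Q : Ω → Prop} (h : ∀ ω, P ω → Q ω) : Pr P ≤ Pr Q := by
  unfold Pr
  gcongr with ω hω
  exact h ω

lemma Pr_nonneg (P : Ω → Prop) : 0 ≤ Pr P := by unfold Pr; positivity

lemma Pr_or (P Q : Ω → Prop) : Pr (fun ω => P ω ∨ Q ω) ≤ Pr P + Pr Q := by
  unfold Pr
  rw [← add_div]
  gcongr
  have := card_union_le (univ.filter P) (univ.filter Q)
  rw [← filter_or] at this
  have h2 : ((univ.filter (fun a => P a ∨ Q a)).card : ℝ)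
      ≤ (univ.filter P).card + (univ.filter Q).card := by exact_mod_cast this
  refine le_trans (le_of_eq ?_) h2
  congr!

lemma Pr_biUnion {ι : Type*} (s : Finset ι) (P : ι → Ω → Prop) :
    Pr (fun ω => ∃ i ∈ s, P i ω) ≤ ∑ i ∈ s, Pr (P i) := by
  induction s using Finset.induction_on with
  | empty => simp [Pr]
  | insert a s ha ih =>
    rw [sum_insert ha]
    refine le_trans (le_trans (Pr_mono ?_) (Pr_or (P a) (fun ω => ∃ i ∈ s, P i ω))) (by linarith)
    intro ω h
    simpa using h

lemma Pr_biUnion_le {ι : Type*} (s : Finset ι) (P : ι → Ω → Prop) (ε : ℝ)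
    (h : ∀ i ∈ s, Pr (P i) ≤ ε) :
    Pr (fun ω => ∃ i ∈ s, P i ω) ≤ s.card * ε := by
  refine (Pr_biUnion s P).trans ?_
  refine (sum_le_sum h).trans ?_
  simp

lemma Pr_le_Ex {P : Ω → Prop} {f : Ω → ℝ} (h0 : ∀ ω, 0 ≤ f ω) (h : ∀ ω, P ω → 1 ≤ f ω) :
    Pr P ≤ Ex f := by
  unfold Pr Ex
  gcongr
  rw [card_eq_sum_ones, Nat.cast_sum, sum_filter]
  refine sum_le_sum fun ω _ => ?_
  split_ifs with hP
  · simpa using h ω hP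
  · exact h0 ω

lemma Ex_mono {f g : Ω → ℝ} (h : ∀ ω, f ω ≤ g ω) : Ex f ≤ Ex g := by
  unfold Ex; gcongr; exact h _

lemma Ex_nonneg {f : Ω → ℝ} (h : ∀ ω, 0 ≤ f ω) : 0 ≤ Ex f :=
  div_nonneg (sum_nonneg fun _ _ => h _) (by positivity)

lemma Ex_add (f g : Ω → ℝ) : Ex (fun ω => f ω + g ω) = Ex f + Ex g := by
  unfold Ex; rw [sum_add_distrib, add_div]

lemma Ex_mul (c : ℝ) (f : Ω → ℝ) : Ex (fun ω => c * f ω) = c * Ex f := by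
  unfold Ex; rw [← mul_sum, mul_div_assoc]

lemma Ex_sum {ι : Type*} (s : Finset ι) (f : ι → Ω → ℝ) :
    Ex (fun ω => ∑ i ∈ s, f i ω) = ∑ i ∈ s, Ex (f i) := by
  unfold Ex; rw [sum_comm, sum_div]

lemma Ex_const [Nonempty Ω] (c : ℝ) : Ex (fun _ : Ω => c) = c := by
  unfold Ex; simp

lemma Pr_eq_Ex (P : Ω → Prop) [DecidablePred P] :
    Pr P = Ex (fun ω => if P ω then (1:ℝ) else 0) := by
  unfold Pr Ex; simp; congr!

lemma exists_not_of_Pr [Nonempty Ω] {P : Ω → Prop} (h : Pr P < 1) : ∃ ω, ¬ P ω := by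
  by_contra! hc
  have : Pr P = 1 := by
    unfold Pr
    rw [filter_true_of_mem (fun ω _ => hc ω)]
    simp
  linarith

lemma Ex_equiv {Ω' : Type*} [Fintype Ω'] (e : Ω ≃ Ω') (f : Ω' → ℝ) :
    Ex (fun ω => f (e ω)) = Ex f := by
  unfold Ex
  rw [Fintype.card_congr e, e.sum_comp]

lemma Pr_equiv {Ω' : Type*} [Fintype Ω'] (e : Ω ≃ Ω') (P : Ω' → Prop) :
    Pr (fun ω => P (e ω)) = Pr P := by
  rw [Pr_eq_Ex, Pr_eq_Ex]
  exact Ex_equiv e (fun ω => if P ω then (1:ℝ) else 0)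

lemma Pr_prod_left {Ω' : Type*} [Fintype Ω'] (P : Ω × Ω' → Prop) (ε : ℝ) (hε : 0 ≤ ε)
    (h : ∀ ω', Pr (fun ω => P (ω, ω')) ≤ ε) : Pr P ≤ ε := by
  rcases isEmpty_or_nonempty Ω with h1 | h1
  · have : Pr P = 0 := by unfold Pr; simp
    linarith
  rcases isEmpty_or_nonempty Ω' with h2 | h2
  · have : Pr P = 0 := by unfold Pr; simp
    linarith
  have hc : (0:ℝ) < Fintype.card Ω := by exact_mod_cast Fintype.card_pos
  have hc' : (0:ℝ) < Fintype.card Ω' := by exact_mod_cast Fintype.card_pos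
  rw [Pr_eq_Ex]
  unfold Ex
  rw [Fintype.sum_prod_type_right, Fintype.card_prod, div_le_iff₀ (by push_cast; positivity)]
  calc _ ≤ ∑ _y : Ω', ε * Fintype.card Ω := by
        refine sum_le_sum fun y _ => ?_
        have := h y
        rw [Pr_eq_Ex] at this
        unfold Ex at this
        rwa [div_le_iff₀ hc] at this
    _ = _ := by simp; ring

lemma Pr_prod_right {Ω' : Type*} [Fintype Ω'] (P : Ω × Ω' → Prop) (ε : ℝ) (hε : 0 ≤ ε)
    (h : ∀ ω, Pr (fun ω' => P (ω, ω')) ≤ ε) : Pr P ≤ ε := by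
  rw [← Pr_equiv (Equiv.prodComm Ω' Ω)]
  exact Pr_prod_left _ ε hε h

end prob

section pi
variable {ι α : Type*} [Fintype ι] [DecidableEq ι] [Fintype α]

lemma Ex_prod (g : ι → α → ℝ) :
    Ex (fun ω : ι → α => ∏ i, g i (ω i)) = ∏ i, Ex (g i) := by
  unfold Ex
  rw [Finset.prod_div_distrib]
  simp only [prod_const, card_univ]
  rw [Finset.prod_univ_sum]
  simp

lemma Ex_prod_mem [Nonempty α] (E : Finset ι) (g : α → ℝ) :
    Ex (fun ω : ι → α => ∏ i ∈ E, g (ω i)) = (Ex g) ^ E.card := by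
  have h := Ex_prod (fun (i : ι) (x : α) => if i ∈ E then g x else 1)
  have h1 : (fun ω : ι → α => ∏ i, (if i ∈ E then g (ω i) else 1)) =
      fun ω => ∏ i ∈ E, g (ω i) := by
    funext ω
    rw [Finset.prod_ite_mem]; simp
  rw [h1] at h
  rw [h]
  have : ∀ i, Ex (fun x : α => if i ∈ E then g x else 1) = if i ∈ E then Ex g else 1 := by
    intro i
    split_ifs with hi
    · rfl
    · exact Ex_const 1
  simp only [this]
  rw [Finset.prod_ite_mem]; simp

lemma Pr_forall_mem [Nonempty α] (E : Finset ι) (Z : Finset α) :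
    Pr (fun ω : ι → α => ∀ i ∈ E, ω i ∈ Z) = ((Z.card : ℝ) / Fintype.card α) ^ E.card := by
  rw [Pr_eq_Ex]
  have := Ex_prod_mem (ι := ι) E (fun x : α => if x ∈ Z then (1:ℝ) else 0)
  have h2 : Ex (fun x : α => if x ∈ Z then (1:ℝ) else 0) = (Z.card : ℝ) / Fintype.card α := by
    rw [← Pr_eq_Ex]; unfold Pr; simp
  rw [h2] at this
  rw [← this]
  congr 1
  funext ω
  rw [Finset.prod_ite_zero]
  simp

end pi

lemma choose_le_exp (N t : ℕ) : (N.choose t : ℝ) ≤ (3 * N / t) ^ t := by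
  rcases Nat.eq_zero_or_pos t with rfl | ht
  · simp
  have h1 : (N.choose t : ℝ) ≤ (N:ℝ)^t / t.factorial := Nat.choose_le_pow_div t N
  have h2 : (t:ℝ)^t / t.factorial ≤ Real.exp t := Real.pow_div_factorial_le_exp (t:ℝ) (by positivity) t
  have h3 : Real.exp t ≤ 3 ^ t := by
    have : Real.exp 1 ≤ 3 := Real.exp_one_lt_three.le
    calc Real.exp t = Real.exp 1 ^ t := by rw [← Real.exp_nat_mul]; simp
      _ ≤ _ := by gcongr
  have ht' : (0:ℝ) < t := by exact_mod_cast ht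
  calc _ ≤ (N:ℝ)^t / t.factorial := h1
    _ = (N / t)^t * ((t:ℝ)^t / t.factorial) := by
      rw [div_pow]; field_simp
    _ ≤ (N / t)^t * 3^t := by gcongr; exact h2.trans h3
    _ = _ := by rw [← mul_pow]; congr 1; ring

end

end RTF


namespace RTF
open Finset
open scoped Classical

noncomputable section

/-- Bipartite graph with prescribed degrees in the range from D to twice D on two copies of a set `X`. -/
lemma exists_biregular {V : Type*} [DecidableEq V] (X : Finset V) (d : V → ℕ) (D : ℕ)
    (hd1 : ∀ v ∈ X, D ≤ d v) (hd2 : ∀ v ∈ X, d v ≤ 2 * D) (hX : 6 * D < X.card) :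
    ∃ B : Finset (V × V), B ⊆ X ×ˢ X ∧
      (∀ v ∈ X, (B.filter (fun e => e.1 = v)).card = d v) ∧
      (∀ v ∈ X, (B.filter (fun e => e.2 = v)).card = d v) := by
  let good : Finset (V × V) → Prop := fun B =>
    (∀ v ∈ X, (B.filter (fun e => e.1 = v)).card ≤ d v) ∧
      (∀ v ∈ X, (B.filter (fun e => e.2 = v)).card ≤ d v)
  obtain ⟨B, hB, hmax⟩ := Finset.exists_max_image ((X ×ˢ X).powerset.filter good) Finset.card
    ⟨∅, by simp [good]⟩
  rw [mem_filter, mem_powerset] at hB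
  obtain ⟨hBX, hB1, hB2⟩ := hB
  have hsum1 : ∑ v ∈ X, (B.filter (fun e => e.1 = v)).card = B.card :=
    (card_eq_sum_card_fiberwise (f := Prod.fst) (fun e he => (mem_product.1 (hBX he)).1)).symm
  have hsum2 : ∑ v ∈ X, (B.filter (fun e => e.2 = v)).card = B.card :=
    (card_eq_sum_card_fiberwise (f := Prod.snd) (fun e he => (mem_product.1 (hBX he)).2)).symm
  -- if total equals then done
  by_cases htot : B.card = ∑ v ∈ X, d v
  · refine ⟨B, hBX, ?_, ?_⟩
    · exact (Finset.sum_eq_sum_iff_of_le hB1).1 (by rw [hsum1, htot])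
    · exact (Finset.sum_eq_sum_iff_of_le hB2).1 (by rw [hsum2, htot])
  exfalso
  obtain ⟨i, hi, hid⟩ : ∃ i ∈ X, (B.filter (fun e => e.1 = i)).card < d i := by
    by_contra! h
    exact htot (by rw [← hsum1]; exact sum_congr rfl fun v hv => le_antisymm (hB1 v hv) (h v hv))
  obtain ⟨j, hj, hjd⟩ : ∃ j ∈ X, (B.filter (fun e => e.2 = j)).card < d j := by
    by_contra! h
    exact htot (by rw [← hsum2]; exact sum_congr rfl fun v hv => le_antisymm (hB2 v hv) (h v hv))
  -- L : columns missing from row i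
  let L := X.filter (fun l => (i, l) ∉ B)
  let K := X.filter (fun k => (k, j) ∉ B)
  let Kc := X.filter (fun k => (k, j) ∈ B)
  have hLcard : X.card < L.card + 2 * D := by
    have h1 : (X.filter (fun l => (i, l) ∈ B)).card ≤ (B.filter (fun e => e.1 = i)).card := by
      refine card_le_card_of_injOn (fun l => (i, l)) ?_ ?_
      · intro l hl
        simp only [coe_filter, Set.mem_ofPred_eq] at hl ⊢
        simp [hl.2]
      · intro a _ b _ h; simpa using h
    have h2 := card_filter_add_card_filter_not (s := X) (fun l => (i, l) ∈ B)
    have := hd2 i hi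
    simp only [L]
    omega
  have hKc : Kc.card < 2 * D := by
    have h1 : Kc.card ≤ (B.filter (fun e => e.2 = j)).card := by
      refine card_le_card_of_injOn (fun l => (l, j)) ?_ ?_
      · intro l hl
        simp only [Kc, coe_filter, Set.mem_ofPred_eq] at hl ⊢
        simp [hl.2]
      · intro a _ b _ h; simpa using h
    have := hd2 j hj
    omega
  have hfst : ∀ (e : V × V) (v : V), e ∉ B → ((insert e B).filter (fun e => e.1 = v)).card
      = (B.filter (fun e => e.1 = v)).card + if e.1 = v then 1 else 0 := by
    intro e v he
    rw [filter_insert]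
    split_ifs with h
    · rw [card_insert_of_notMem (by simp [he])]
    · simp
  have hsnd : ∀ (e : V × V) (v : V), e ∉ B → ((insert e B).filter (fun e => e.2 = v)).card
      = (B.filter (fun e => e.2 = v)).card + if e.2 = v then 1 else 0 := by
    intro e v he
    rw [filter_insert]
    split_ifs with h
    · rw [card_insert_of_notMem (by simp [he])]
    · simp
  have hLfull : ∀ l ∈ L, (B.filter (fun e => e.2 = l)).card = d l := by
    intro l hl
    simp only [L, mem_filter] at hl
    by_contra hne
    have hlt := lt_of_le_of_ne (hB2 l hl.1) hne
    have := hmax (insert (i, l) B) (by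
      rw [mem_filter, mem_powerset]
      refine ⟨insert_subset (by simp [hi, hl.1]) hBX, ?_, ?_⟩
      · intro v hv
        rw [hfst _ _ hl.2]
        have := hB1 v hv
        split_ifs with h
        · simp only at h; subst h; omega
        · omega
      · intro v hv
        rw [hsnd _ _ hl.2]
        have := hB2 v hv
        split_ifs with h
        · simp only at h; subst h; omega
        · omega)
    rw [card_insert_of_notMem hl.2] at this
    omega
  have hKL : ∀ k ∈ K, ∀ l ∈ L, (k, l) ∉ B := by
    intro k hk l hl hkl
    simp only [L, K, mem_filter] at hk hl
    have hil : (i, l) ≠ (k, l) := fun h => hl.2 (h ▸ hkl)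
    have hkj : (k, j) ≠ (k, l) := fun h => hk.2 (h ▸ hkl)
    have hijkl : (i, l) ≠ (k, j) := by
      intro h
      simp only [Prod.mk.injEq] at h
      exact hkj (by rw [h.2])
    have hik : i ≠ k := fun h => hil (by rw [h])
    have hjl : j ≠ l := fun h => hkj (by rw [h])
    let B' := insert (i, l) (insert (k, j) (B.erase (k, l)))
    have n1 : (k, j) ∉ B.erase (k, l) := fun h => hk.2 (mem_of_mem_erase h)
    have n2 : (i, l) ∉ insert (k, j) (B.erase (k, l)) := by
      rw [mem_insert]; rintro (h | h)
      · exact hijkl h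
      · exact hl.2 (mem_of_mem_erase h)
    have c1 : ∀ v, (B'.filter (fun e => e.1 = v)).card
        ≤ (B.filter (fun e => e.1 = v)).card + if i = v then 1 else 0 := by
      intro v
      simp only [B', filter_insert]
      rw [filter_erase]
      by_cases h2 : k = v
      · have h1 : i ≠ v := fun h => hik (h.trans h2.symm)
        simp only [h1, h2, if_true, if_false]
        have hm : (v, l) ∈ B.filter (fun e => e.1 = v) := by simp [← h2, hkl]
        have := card_erase_add_one hm
        have := card_insert_le (v, j) ((B.filter (fun e => e.1 = v)).erase (v, l))
        omega
      · simp only [h2, if_false]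
        have h3 : ((B.filter (fun e => e.1 = v)).erase (k, l)).card
          ≤ (B.filter (fun e => e.1 = v)).card := card_erase_le
        split_ifs with h1
        · have := card_insert_le (i, l) ((B.filter (fun e => e.1 = v)).erase (k, l))
          omega
        · omega
    have c2 : ∀ v, (B'.filter (fun e => e.2 = v)).card
        ≤ (B.filter (fun e => e.2 = v)).card + if j = v then 1 else 0 := by
      intro v
      simp only [B', filter_insert]
      rw [filter_erase]
      by_cases h2 : l = v
      · have h1 : j ≠ v := fun h => hjl (h.trans h2.symm)
        simp only [h1, h2, if_true, if_false]
        have hm : (k, v) ∈ B.filter (fun e => e.2 = v) := by simp [← h2, hkl]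
        have := card_erase_add_one hm
        have := card_insert_le (i, v) ((B.filter (fun e => e.2 = v)).erase (k, v))
        omega
      · simp only [h2, if_false]
        have h3 : ((B.filter (fun e => e.2 = v)).erase (k, l)).card
          ≤ (B.filter (fun e => e.2 = v)).card := card_erase_le
        split_ifs with h1
        · have := card_insert_le (k, j) ((B.filter (fun e => e.2 = v)).erase (k, l))
          omega
        · omega
    have hc : B'.card = B.card + 1 := by
      simp only [B']
      rw [card_insert_of_notMem n2, card_insert_of_notMem n1, card_erase_add_one hkl]
    have := hmax B' (by
      rw [mem_filter, mem_powerset]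
      refine ⟨?_, ?_, ?_⟩
      · refine insert_subset (by simp [hi, hl.1]) (insert_subset (by simp [hk.1, hj]) ?_)
        exact (erase_subset _ _).trans hBX
      · intro v hv
        have h1 := c1 v
        have h2 := hB1 v hv
        split_ifs at h1 with h
        · subst h; omega
        · omega
      · intro v hv
        have h1 := c2 v
        have h2 := hB2 v hv
        split_ifs at h1 with h
        · subst h; omega
        · omega)
    omega
  -- double count edges in Kc × L
  have hE1 : L.card * D ≤ (B.filter (fun e => e.2 ∈ L)).card := by
    have hmaps : ∀ e ∈ B.filter (fun e => e.2 ∈ L), e.2 ∈ L := fun e he => (mem_filter.1 he).2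
    rw [card_eq_sum_card_fiberwise (f := Prod.snd) (t := L) hmaps]
    rw [← smul_eq_mul]
    refine card_nsmul_le_sum _ _ _ fun l hl => ?_
    have h1 := hLfull l hl
    have h2 := hd1 l (mem_of_mem_filter l hl)
    rw [filter_filter]
    rw [← h1] at h2
    refine h2.trans (card_le_card ?_)
    intro e he
    simp only [mem_filter] at he ⊢
    exact ⟨he.1, he.2 ▸ hl, he.2⟩
  have hE2 : (B.filter (fun e => e.2 ∈ L)).card ≤ Kc.card * (2 * D) := by
    rw [card_eq_sum_card_fiberwise (f := Prod.fst) (t := Kc)]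
    · rw [← smul_eq_mul]
      refine sum_le_card_nsmul _ _ _ fun k hk => ?_
      have hkX := mem_of_mem_filter k hk
      refine le_trans (card_le_card ?_) ((hB1 k hkX).trans (hd2 k hkX))
      intro e he
      simp only [mem_filter] at he ⊢
      exact ⟨he.1.1, he.2⟩
    · intro e he
      simp only [coe_filter, Set.mem_ofPred_eq] at he
      have heX := mem_product.1 (hBX he.1)
      simp only [Kc, coe_filter, Set.mem_ofPred_eq]
      refine ⟨heX.1, ?_⟩
      by_contra hc
      exact hKL e.1 (by simp only [K, mem_filter]; exact ⟨heX.1, hc⟩) e.2 he.2 he.1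
  have hDpos : 0 < D := by
    have := hd2 i hi
    omega
  nlinarith [Nat.mul_le_mul_right (2 * D) hKc.le]

end

end RTF


namespace RTF
open Finset
open scoped Classical

noncomputable section

def TF {W : Type*} (G : SimpleGraph W) : Prop :=
  ∀ a b c, G.Adj a b → G.Adj b c → G.Adj a c → False

def Indep {W : Type*} (G : SimpleGraph W) (S : Finset W) : Prop :=
  ∀ u ∈ S, ∀ v ∈ S, u ≠ v → ¬ G.Adj u v

def Res (W : Type) [Fintype W] (r a : ℕ) : Prop :=
  ∃ G : SimpleGraph W, TF G ∧ (∀ v, (univ.filter (fun w => G.Adj v w)).card = r) ∧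
    ∀ S, Indep G S → S.card ≤ a

lemma card_filter_sum {A B : Type*} [Fintype A] [Fintype B] (P : A ⊕ B → Prop) :
    (univ.filter P).card = (univ.filter (fun a => P (Sum.inl a))).card +
      (univ.filter (fun b => P (Sum.inr b))).card := by
  rw [card_filter, card_filter, card_filter, Fintype.sum_sum_type]

lemma card_le_sum {A B : Type*} [Fintype A] [Fintype B] (S : Finset (A ⊕ B)) (a b : ℕ)
    (ha : (univ.filter (fun x => Sum.inl x ∈ S)).card ≤ a)
    (hb : (univ.filter (fun x => Sum.inr x ∈ S)).card ≤ b) : S.card ≤ a + b := by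
  have := card_filter_sum (fun x => x ∈ S)
  have h2 : (univ.filter (fun x => x ∈ S)).card = S.card := by congr 1; ext; simp
  have h3 : S.card = (univ.filter (fun x => Sum.inl x ∈ S)).card
      + (univ.filter (fun x => Sum.inr x ∈ S)).card := by
    rw [← h2]; convert this
  omega

lemma Res_equiv {W W' : Type} [Fintype W] [Fintype W'] (e : W' ≃ W) {r a : ℕ}
    (h : Res W r a) : Res W' r a := by
  obtain ⟨G, h1, h2, h3⟩ := h
  refine ⟨G.comap e, fun a b c hab hbc hac => h1 _ _ _ hab hbc hac, fun v => ?_, fun S hS => ?_⟩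
  · rw [← h2 (e v)]
    refine card_bij (fun w _ => e w) ?_ ?_ ?_
    · intro w hw; simpa using hw
    · intro w _ w' _ h; exact e.injective h
    · intro w hw; exact ⟨e.symm w, by simpa using hw, by simp⟩
  · have := h3 (S.map e.toEmbedding) (by
      intro u hu v hv huv hadj
      simp only [mem_map, Equiv.coe_toEmbedding] at hu hv
      obtain ⟨u, hu, rfl⟩ := hu
      obtain ⟨v, hv, rfl⟩ := hv
      exact hS u hu v hv (fun h => huv (by rw [h])) hadj)
    simpa using this

lemma Res_sum {W W' : Type} [Fintype W] [Fintype W'] {r a a' : ℕ}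
    (h : Res W r a) (h' : Res W' r a') : Res (W ⊕ W') r (a + a') := by
  obtain ⟨G, h1, h2, h3⟩ := h
  obtain ⟨G', h1', h2', h3'⟩ := h'
  refine ⟨G ⊕g G', ?_, ?_, ?_⟩
  · rintro (a | a) (b | b) (c | c) hab hbc hac <;> simp at hab hbc hac
    · exact h1 _ _ _ hab hbc hac
    · exact h1' _ _ _ hab hbc hac
  · rintro (v | v)
    · rw [card_filter_sum]; simp [h2]
    · rw [card_filter_sum]; simp [h2']
  · intro S hS
    refine card_le_sum S _ _ (h3 _ ?_) (h3' _ ?_)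
    · intro u hu v hv huv hadj
      simp only [mem_filter, mem_univ, true_and] at hu hv
      exact hS _ hu _ hv (by simpa using huv) (by simpa using hadj)
    · intro u hu v hv huv hadj
      simp only [mem_filter, mem_univ, true_and] at hu hv
      exact hS _ hu _ hv (by simpa using huv) (by simpa using hadj)

lemma Res_double {V : Type} [Fintype V] {ι : Type*} (G : SimpleGraph V) (c : V → ι) (D a : ℕ)
    (hTF : TF G) (hc : ∀ u v, G.Adj u v → c u ≠ c v)
    (hdeg : ∀ v, (univ.filter (fun w => G.Adj v w)).card ≤ D)
    (hcl : ∀ v, 6 * D < (univ.filter (fun u => c u = c v)).card)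
    (ha : ∀ S, Indep G S → S.card ≤ a) : Res (V ⊕ V) (2 * D) (a + a) := by
  set d : V → ℕ := fun v => 2 * D - (univ.filter (fun w => G.Adj v w)).card with hd
  have hB : ∀ i : ι, ∃ B : Finset (V × V),
      B ⊆ (univ.filter (fun u => c u = i)) ×ˢ (univ.filter (fun u => c u = i)) ∧
      (∀ v, c v = i → (B.filter (fun e => e.1 = v)).card = d v) ∧
      (∀ v, c v = i → (B.filter (fun e => e.2 = v)).card = d v) := by
    intro i
    by_cases hi : ∃ v, c v = i
    · obtain ⟨v, rfl⟩ := hi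
      obtain ⟨B, h1, h2, h3⟩ := exists_biregular (univ.filter (fun u => c u = c v)) d D
        (fun u _ => by have := hdeg u; simp only [hd]; omega)
        (fun u _ => by simp only [hd]; omega) (hcl v)
      exact ⟨B, h1, fun u hu => h2 u (by simpa using hu), fun u hu => h3 u (by simpa using hu)⟩
    · push Not at hi
      exact ⟨∅, by simp, fun v hv => absurd hv (hi v), fun v hv => absurd hv (hi v)⟩
  choose B hB1 hB2 hB3 using hB
  have hBc : ∀ i u v, (u, v) ∈ B i → c u = i ∧ c v = i := by
    intro i u v h
    have := hB1 i h
    simpa using this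
  let adj : V ⊕ V → V ⊕ V → Prop := fun p q => match p, q with
    | Sum.inl u, Sum.inl v => G.Adj u v
    | Sum.inr u, Sum.inr v => G.Adj u v
    | Sum.inl u, Sum.inr v => (u, v) ∈ B (c u)
    | Sum.inr v, Sum.inl u => (u, v) ∈ B (c u)
  let H : SimpleGraph (V ⊕ V) := {
    Adj := adj
    symm := ⟨by
      rintro (u | u) (v | v) h <;> simp only [adj] at h ⊢
      · exact h.symm
      · exact h
      · exact h
      · exact h.symm⟩
    loopless := ⟨by
      rintro (u | u) h <;> simp only [adj] at h
      · exact G.loopless.irrefl u h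
      · exact G.loopless.irrefl u h⟩ }
  refine ⟨H, ?_, ?_, ?_⟩
  · rintro (x | x) (y | y) (z | z) hxy hyz hxz <;> simp only [H, adj] at hxy hyz hxz
    · exact hTF _ _ _ hxy hyz hxz
    · exact hc _ _ hxy ((hBc _ _ _ hxz).2.symm.trans (hBc _ _ _ hyz).2)
    · exact hc _ _ hxz ((hBc _ _ _ hxy).2.symm.trans (hBc _ _ _ hyz).2)
    · have h1 := hBc _ _ _ hxy
      have h2 := hBc _ _ _ hxz
      exact hc _ _ hyz (h1.2.trans h2.2.symm)
    · have h1 := hBc _ _ _ hxy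
      have h2 := hBc _ _ _ hxz
      exact hc _ _ hyz (h1.2.symm.trans h2.2)
    · exact hc _ _ hxz ((hBc _ _ _ hxy).2.trans (hBc _ _ _ hyz).2.symm)
    · exact hc _ _ hxy ((hBc _ _ _ hxz).2.trans (hBc _ _ _ hyz).2.symm)
    · exact hTF _ _ _ hxy hyz hxz
  · rintro (v | v)
    · rw [card_filter_sum]
      simp only [H, adj]
      have h1 : (univ.filter (fun b => (v, b) ∈ B (c v))).card
          = ((B (c v)).filter (fun e => e.1 = v)).card := by
        refine card_bij (fun b _ => (v, b)) ?_ ?_ ?_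
        · intro b hb; simpa using hb
        · intro b _ b' _ h; simpa using h
        · rintro ⟨x, y⟩ h
          simp only [mem_filter] at h
          obtain ⟨h, rfl⟩ := h
          exact ⟨y, by simpa using h, rfl⟩
      rw [h1, hB2 _ _ rfl]
      have := hdeg v
      simp only [hd]; omega
    · rw [card_filter_sum]
      simp only [H, adj]
      have h1 : (univ.filter (fun a => (a, v) ∈ B (c a))).card
          = ((B (c v)).filter (fun e => e.2 = v)).card := by
        refine card_bij (fun b _ => (b, v)) ?_ ?_ ?_
        · intro b hb
          simp only [mem_filter, mem_univ, true_and] at hb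
          have := hBc _ _ _ hb
          rw [← this.2] at hb
          simpa using hb
        · intro b _ b' _ h; simpa using h
        · rintro ⟨x, y⟩ h
          simp only [mem_filter] at h
          obtain ⟨h, rfl⟩ := h
          have := hBc _ _ _ h
          rw [← this.1] at h
          exact ⟨x, by simpa using h, rfl⟩
      rw [h1, hB3 _ _ rfl]
      have := hdeg v
      simp only [hd]; omega
  · intro S hS
    refine card_le_sum S _ _ (ha _ ?_) (ha _ ?_)
    · intro u hu v hv huv hadj
      simp only [mem_filter, mem_univ, true_and] at hu hv
      exact hS _ hu _ hv (by simpa using huv) hadj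
    · intro u hu v hv huv hadj
      simp only [mem_filter, mem_univ, true_and] at hu hv
      exact hS _ hu _ hv (by simpa using huv) hadj

/-- circulant gadget -/
lemma Res_circ (g h : ℕ) (hg : 8 * h + 1 ≤ g) : Res (Fin g) (2 * h) g := by
  have : NeZero g := ⟨by omega⟩
  suffices Res (ZMod g) (2 * h) g from
    Res_equiv (Fintype.equivOfCardEq (by simp [ZMod.card])) this
  set a := g / 3 + 1 with hadef
  let P : ℕ → Prop := fun x => (a ≤ x ∧ x < a + h) ∨ (a + x ≤ g ∧ g < a + h + x)
  have hneg : ∀ x : ZMod g, P x.val → P (-x).val := by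
    intro x hx
    have hlt := x.val_lt
    rw [ZMod.neg_val]
    split_ifs with h0
    · subst h0; simp only [P, ZMod.val_zero] at hx ⊢; omega
    · simp only [P] at hx ⊢; omega
  let H : SimpleGraph (ZMod g) := {
    Adj := fun i j => P (i - j).val
    symm := ⟨by
      intro i j hij
      have := hneg _ hij
      rwa [neg_sub] at this⟩
    loopless := ⟨by
      intro i hi
      simp only [sub_self, ZMod.val_zero, P] at hi
      omega⟩ }
  refine ⟨H, ?_, ?_, ?_⟩
  · intro i j k hij hjk hik
    have hki := hneg _ hik
    rw [neg_sub] at hki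
    simp only [H] at hij hjk
    have hsum : ((((i - j).val + (j - k).val + (k - i).val : ℕ)) : ZMod g) = 0 := by
      push_cast
      rw [ZMod.natCast_zmod_val, ZMod.natCast_zmod_val, ZMod.natCast_zmod_val]
      ring
    rw [ZMod.natCast_eq_zero_iff] at hsum
    obtain ⟨m, hm⟩ := hsum
    have b1 : g < 3 * (i - j).val ∧ 3 * (i - j).val < 2 * g := by simp only [P] at hij; omega
    have b2 : g < 3 * (j - k).val ∧ 3 * (j - k).val < 2 * g := by simp only [P] at hjk; omega
    have b3 : g < 3 * (k - i).val ∧ 3 * (k - i).val < 2 * g := by simp only [P] at hki; omega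
    have l1 : g * 1 < g * m := by omega
    have l2 : g * m < g * 2 := by omega
    have := Nat.lt_of_mul_lt_mul_left l1
    have := Nat.lt_of_mul_lt_mul_left l2
    omega
  · intro v
    have e1 : (univ.filter (fun w => H.Adj v w)).card = (univ.filter (fun x : ZMod g => P x.val)).card := by
      refine card_bij (fun w _ => v - w) ?_ ?_ ?_
      · intro w hw; simpa [H] using hw
      · intro w _ w' _ h; simpa using h
      · intro x hx; exact ⟨v - x, by simpa [H] using hx, by simp⟩
    have e2 : (univ.filter (fun x : ZMod g => P x.val)).card =
        ((Ico a (a + h)) ∪ (Ico (g + 1 - a - h) (g + 1 - a))).card := by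
      refine card_bij (fun x _ => x.val) ?_ ?_ ?_
      · intro x hx
        simp only [mem_filter, mem_univ, true_and, P] at hx
        simp only [mem_union, mem_Ico]
        have := x.val_lt
        omega
      · intro x _ y _ h; exact ZMod.val_injective g h
      · intro x hx
        simp only [mem_union, mem_Ico] at hx
        have hlt : x < g := by omega
        refine ⟨(x : ZMod g), ?_, ZMod.val_cast_of_lt hlt⟩
        simp only [mem_filter, mem_univ, true_and, ZMod.val_cast_of_lt hlt, P]
        omega
    have e3 : ((Ico a (a + h)) ∪ (Ico (g + 1 - a - h) (g + 1 - a))).card = 2 * h := by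
      rw [card_union_of_disjoint, Nat.card_Ico, Nat.card_Ico]
      · omega
      rw [disjoint_left]
      intro x hx hx'
      simp only [mem_Ico] at hx hx'
      omega
    rw [e3] at e2
    rw [e2] at e1
    convert e1
  · intro S _
    have := card_le_univ S
    rwa [ZMod.card] at this

end

end RTF


namespace RTF
open Finset
open scoped Classical

noncomputable section

section tri
variable {M : Type} [Fintype M] [LinearOrder M] {q : ℕ}

/-- code of an unordered pair -/
def ed (i j : M) : M × M := (min i j, max i j)

lemma ed_comm (i j : M) : ed i j = ed j i := by
  unfold ed; rw [min_comm, max_comm]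

lemma ed_eq_iff (i j k l : M) : ed i j = ed k l ↔ (i = k ∧ j = l) ∨ (i = l ∧ j = k) := by
  unfold ed
  rw [Prod.mk.injEq]
  constructor
  · rintro ⟨h1, h2⟩
    rcases le_total i j with h | h <;> rcases le_total k l with h' | h' <;>
      simp [h, h'] at h1 h2 <;> simp [h1, h2]
  · rintro (⟨rfl, rfl⟩ | ⟨rfl, rfl⟩)
    · simp
    · exact ⟨min_comm _ _, max_comm _ _⟩

/-- edges of a triple -/
def te (t : M × M × M) : Finset (M × M) := {ed t.1 t.2.1, ed t.1 t.2.2, ed t.2.1 t.2.2}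

def IsTri (a : M × M → Fin q) (t : M × M × M) : Prop :=
  t.1 ≠ t.2.1 ∧ t.1 ≠ t.2.2 ∧ t.2.1 ≠ t.2.2 ∧ ∀ e ∈ te t, (a e).val = 0

lemma card_te {t : M × M × M} (h1 : t.1 ≠ t.2.1) (h2 : t.1 ≠ t.2.2) (h3 : t.2.1 ≠ t.2.2) :
    (te t).card = 3 := by
  unfold te
  rw [card_eq_three]
  refine ⟨_, _, _, ?_, ?_, ?_, rfl⟩ <;> rw [Ne, ed_eq_iff] <;> tauto

def GoodFam (a : M × M → Fin q) (D : Finset (M × M × M)) : Prop :=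
  (∀ t ∈ D, IsTri a t) ∧ (∀ t ∈ D, ∀ t' ∈ D, t ≠ t' → Disjoint (te t) (te t'))

lemma exists_fam (a : M × M → Fin q) : ∃ D, GoodFam a D ∧ ∀ D', GoodFam a D' → D'.card ≤ D.card := by
  obtain ⟨D, hD, hmax⟩ := exists_max_image (univ.filter (fun D : Finset (M × M × M) => GoodFam a D))
    Finset.card ⟨∅, by simp [GoodFam]⟩
  refine ⟨D, by simpa using hD, fun D' h => hmax D' (by simpa using h)⟩

def fam (a : M × M → Fin q) : Finset (M × M × M) := (exists_fam a).choose

lemma fam_good (a : M × M → Fin q) : GoodFam a (fam a) := (exists_fam a).choose_spec.1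
lemma fam_max (a : M × M → Fin q) : ∀ D', GoodFam a D' → D'.card ≤ (fam a).card :=
  (exists_fam a).choose_spec.2

/-- removed edges -/
def rem (a : M × M → Fin q) : Finset (M × M) := (fam a).biUnion te

/-- triangle-free random graph -/
def FG (a : M × M → Fin q) : SimpleGraph M where
  Adj i j := i ≠ j ∧ (a (ed i j)).val = 0 ∧ ed i j ∉ rem a
  symm := ⟨by
    intro i j h
    rw [ed_comm]
    exact ⟨h.1.symm, h.2⟩⟩
  loopless := ⟨fun i h => h.1 rfl⟩

lemma FG_tf (a : M × M → Fin q) (i j k : M) (hij : (FG a).Adj i j) (hjk : (FG a).Adj j k)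
    (hik : (FG a).Adj i k) : False := by
  have hg := fam_good a
  let t : M × M × M := (i, j, k)
  have hte : ∀ e ∈ te t, (a e).val = 0 ∧ e ∉ rem a := by
    intro e he
    simp only [te, t, mem_insert, mem_singleton] at he
    rcases he with rfl | rfl | rfl
    · exact hij.2
    · exact hik.2
    · exact hjk.2
  have hdis : ∀ t' ∈ fam a, Disjoint (te t) (te t') := by
    intro t' ht'
    rw [disjoint_left]
    intro e he he'
    exact (hte e he).2 (mem_biUnion.2 ⟨t', ht', he'⟩)
  have hnot : t ∉ fam a := by
    intro h
    exact (hte (ed i j) (by simp [te, t])).2 (mem_biUnion.2 ⟨t, h, by simp [te, t]⟩)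
  have hcard : (te t).card = 3 := card_te hij.1 hik.1 hjk.1
  have := fam_max a (insert t (fam a)) (by
    refine ⟨?_, ?_⟩
    · intro t' ht'
      rcases mem_insert.1 ht' with rfl | h
      · exact ⟨hij.1, hik.1, hjk.1, fun e he => (hte e he).1⟩
      · exact hg.1 _ h
    · intro t1 h1 t2 h2 hne
      rcases mem_insert.1 h1 with rfl | h1 <;> rcases mem_insert.1 h2 with rfl | h2
      · exact absurd rfl hne
      · exact hdis _ h2
      · exact (hdis _ h1).symm
      · exact hg.2 _ h1 _ h2 hne)
  rw [card_insert_of_notMem hnot] at this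
  omega

lemma Pr_zero (hq : 0 < q) (E : Finset (M × M)) :
    Pr (fun a : M × M → Fin q => ∀ e ∈ E, (a e).val = 0) = (1 / (q:ℝ)) ^ E.card := by
  have : Nonempty (Fin q) := ⟨⟨0, hq⟩⟩
  have := Pr_forall_mem (ι := M × M) E ({⟨0, hq⟩} : Finset (Fin q))
  simp only [card_singleton, Fintype.card_fin, mem_singleton, Nat.cast_one] at this
  rw [← this]
  congr 1
  funext a
  simp [Fin.ext_iff]

lemma Ex_ite (hq : 0 < q) (x y : ℝ) :
    Ex (fun z : Fin q => if z.val = 0 then x else y) = y + (x - y) * (1 / q) := by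
  have hq' : (0:ℝ) < q := by exact_mod_cast hq
  have : ∀ z : Fin q, (if z.val = 0 then x else y) = y + if z = ⟨0, hq⟩ then x - y else 0 := by
    intro z
    simp only [Fin.ext_iff]
    split_ifs <;> ring
  unfold Ex
  simp only [this, sum_add_distrib, Fintype.card_fin]
  simp
  field_simp

/-- Chernoff lower tail -/
lemma Pr_few (hq : 0 < q) (Q : Finset (M × M)) (t : ℕ) :
    Pr (fun a : M × M → Fin q => (Q.filter (fun e => (a e).val = 0)).card < t) ≤
      2 ^ t * Real.exp (- (Q.card / (2 * q))) := by
  have hq' : (0:ℝ) < q := by exact_mod_cast hq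
  have : Nonempty (Fin q) := ⟨⟨0, hq⟩⟩
  have h1 : Pr (fun a : M × M → Fin q => (Q.filter (fun e => (a e).val = 0)).card < t) ≤
      Ex (fun a : M × M → Fin q => 2 ^ t * ∏ e ∈ Q, (if (a e).val = 0 then (1/2:ℝ) else 1)) := by
    refine Pr_le_Ex ?_ ?_
    · intro a
      refine mul_nonneg (by positivity) (prod_nonneg fun e _ => ?_)
      split_ifs <;> norm_num
    · intro a ha
      rw [prod_ite]
      simp only [prod_const, one_pow, mul_one]
      rw [one_div, inv_pow, ← div_eq_mul_inv, one_le_div (by positivity)]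
      exact pow_le_pow_right₀ (by norm_num) ha.le
  refine h1.trans ?_
  rw [Ex_mul, Ex_prod_mem (ι := M × M) Q (fun z : Fin q => if z.val = 0 then (1/2:ℝ) else 1), Ex_ite hq]
  gcongr
  have h2 : (1:ℝ) + (1/2 - 1) * (1 / q) ≤ Real.exp (-(1/(2*q))) := by
    have := Real.add_one_le_exp (-(1/(2*(q:ℝ))))
    refine le_trans (le_of_eq ?_) this
    field_simp; ring
  have h3 : (0:ℝ) ≤ 1 + (1/2 - 1) * (1 / q) := by
    have : 1 / (q:ℝ) ≤ 1 := by
      rw [div_le_one hq']; exact_mod_cast hq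
    linarith
  calc _ ≤ (Real.exp (-(1/(2*q)))) ^ Q.card := by gcongr
    _ = _ := by rw [← Real.exp_nat_mul]; congr 1; ring

def triX (X : Finset M) : Finset (M × M × M) :=
  univ.filter (fun t => (t.1 ∈ X ∧ t.2.1 ∈ X) ∨ (t.1 ∈ X ∧ t.2.2 ∈ X) ∨ (t.2.1 ∈ X ∧ t.2.2 ∈ X))

lemma card_triX (X : Finset M) : (triX X).card ≤ 3 * (X.card ^ 2 * Fintype.card M) := by
  have h : triX X ⊆ (X ×ˢ X ×ˢ univ) ∪ ((X ×ˢ univ ×ˢ X) ∪ (univ ×ˢ X ×ˢ X)) := by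
    intro t ht
    simp only [triX, mem_filter, mem_univ, true_and] at ht
    simp only [mem_union, mem_product, mem_univ, true_and, and_true]
    tauto
  refine (card_le_card h).trans ?_
  refine (card_union_le _ _).trans ?_
  have := card_union_le (X ×ˢ (univ : Finset M) ×ˢ X) ((univ : Finset M) ×ˢ X ×ˢ X)
  simp only [card_product, card_univ] at this ⊢
  nlinarith

lemma mem_triX {X : Finset M} {e : M × M} {t : M × M × M} (h1 : e.1 ∈ X) (h2 : e.2 ∈ X)
    (he : e ∈ te t) : t ∈ triX X := by
  have key : ∀ i j : M, (ed i j).1 ∈ X → (ed i j).2 ∈ X → i ∈ X ∧ j ∈ X := by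
    intro i j h h'
    unfold ed at h h'
    rcases le_total i j with hh | hh <;> simp [hh] at h h' <;> tauto
  simp only [te, mem_insert, mem_singleton] at he
  simp only [triX, mem_filter, mem_univ, true_and]
  rcases he with rfl | rfl | rfl
  · exact Or.inl (key _ _ h1 h2)
  · exact Or.inr (Or.inl (key _ _ h1 h2))
  · exact Or.inr (Or.inr (key _ _ h1 h2))

/-- probability of many edge-disjoint triangles -/
lemma Pr_tri (hq : 0 < q) (X : Finset M) (t0 : ℕ) :
    Pr (fun a : M × M → Fin q => t0 ≤ ((fam a).filter (fun t => t ∈ triX X)).card) ≤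
      ((triX X).card.choose t0) * (1 / (q:ℝ)) ^ (3 * t0) := by
  have h1 : ∀ a : M × M → Fin q, t0 ≤ ((fam a).filter (fun t => t ∈ triX X)).card →
      ∃ L ∈ powersetCard t0 (triX X), (∀ e ∈ L.biUnion te, (a e).val = 0) ∧
        (L.biUnion te).card = 3 * t0 := by
    intro a ha
    obtain ⟨L, hL, hLc⟩ := exists_subset_card_eq ha
    have hg := fam_good a
    have hLf : ∀ t ∈ L, t ∈ fam a := fun t ht => mem_of_mem_filter t (hL ht)
    refine ⟨L, ?_, ?_, ?_⟩
    · rw [mem_powersetCard]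
      exact ⟨fun t ht => (mem_filter.1 (hL ht)).2, hLc⟩
    · intro e he
      obtain ⟨t, ht, he⟩ := mem_biUnion.1 he
      exact (hg.1 t (hLf t ht)).2.2.2 e he
    · rw [card_biUnion]
      · rw [sum_congr rfl (fun t ht => card_te (hg.1 t (hLf t ht)).1 (hg.1 t (hLf t ht)).2.1
          (hg.1 t (hLf t ht)).2.2.1)]
        simp [hLc]; ring
      · intro t ht t' ht' hne
        exact hg.2 _ (hLf t ht) _ (hLf t' ht') hne
  refine (Pr_mono h1).trans ?_
  rw [← card_powersetCard]
  refine Pr_biUnion_le (Ω := M × M → Fin q) (powersetCard t0 (triX X)) (fun L a => (∀ e ∈ L.biUnion te, (a e).val = 0) ∧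
        (L.biUnion te).card = 3 * t0) ((1 / (q:ℝ)) ^ (3 * t0)) ?_
  intro L _
  by_cases hL : (L.biUnion te).card = 3 * t0
  · rw [← hL, ← Pr_zero hq]
    exact Pr_mono fun a h => h.1
  · refine (Pr_mono (Q := fun _ => False) fun a h => hL h.2).trans ?_
    simp [Pr]

/-- every edge of `F` in `Q` is removed: unlikely -/
lemma Pr_main (s b κ : ℕ) (hs : 0 < s) (hb : 0 < b) (hM : Fintype.card M = s ^ 2)
    (hκ : κ = 2 ^ 20 * s * b) (hq : q = 512 * s)
    (X : Finset M) (hX : X.card ≤ κ) (Q : Finset (M × M)) (hQX : Q ⊆ X ×ˢ X)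
    (hQ : κ ^ 2 ≤ 4 * Q.card) :
    Pr (fun a : M × M → Fin q => ∀ e ∈ Q, (a e).val = 0 → e ∈ rem a) ≤
      2 * (1 / 2) ^ (8 * (32 * b * κ)) := by
  have hq0 : 0 < q := by omega
  set t0 := 32 * b * κ with ht0
  have hκ0 : 0 < κ := by rw [hκ]; positivity
  have ht00 : 0 < t0 := by positivity
  have hsR : (0:ℝ) < s := by exact_mod_cast hs
  have h1 : ∀ a : M × M → Fin q, (∀ e ∈ Q, (a e).val = 0 → e ∈ rem a) →
      (Q.filter (fun e => (a e).val = 0)).card < 3 * t0 ∨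
      t0 ≤ ((fam a).filter (fun t => t ∈ triX X)).card := by
    intro a ha
    by_contra! hcon
    obtain ⟨hc1, hc2⟩ := hcon
    have hsub : Q.filter (fun e => (a e).val = 0) ⊆
        ((fam a).filter (fun t => t ∈ triX X)).biUnion te := by
      intro e he
      rw [mem_filter] at he
      have := ha e he.1 he.2
      obtain ⟨t, ht, het⟩ := mem_biUnion.1 this
      have hx := mem_product.1 (hQX he.1)
      exact mem_biUnion.2 ⟨t, mem_filter.2 ⟨ht, mem_triX hx.1 hx.2 het⟩, het⟩
    have h2 := card_le_card hsub
    have h3 : (((fam a).filter (fun t => t ∈ triX X)).biUnion te).card ≤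
        ((fam a).filter (fun t => t ∈ triX X)).card * 3 := by
      refine card_biUnion_le_card_mul _ _ _ fun t _ => ?_
      exact card_le_three
    omega
  refine (Pr_mono h1).trans ((Pr_or _ _).trans ?_)
  rw [two_mul]
  have hQR : (κ:ℝ) ^ 2 ≤ 4 * Q.card := by exact_mod_cast hQ
  have ht0R : (t0 : ℝ) = (κ:ℝ)^2 / (64 * q) := by
    rw [ht0, hq]; push_cast
    have : (κ:ℝ) = 2^20 * s * b := by rw [hκ]; push_cast; ring
    rw [this]; field_simp; norm_num
  have hqR : (0:ℝ) < q := by exact_mod_cast hq0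
  clear_value t0
  refine add_le_add ?_ ?_
  · refine (Pr_few hq0 Q (3 * t0)).trans ?_
    have h4 : (8 * t0 : ℝ) ≤ Q.card / (2 * q) := by
      rw [ht0R]
      rw [le_div_iff₀ (by positivity)]
      calc _ = (κ:ℝ)^2 / 4 := by field_simp; norm_num
        _ ≤ _ := by linarith
    have h5 : Real.exp (-(Q.card / (2 * q))) ≤ Real.exp (-8) ^ t0 := by
      rw [← Real.exp_nat_mul]
      apply Real.exp_le_exp.2
      linarith
    have h6 : Real.exp (-8) ≤ 1 / 2 ^ 11 := by
      rw [Real.exp_neg, one_div]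
      apply inv_anti₀ (by positivity)
      have : (2.7182818283:ℝ) < Real.exp 1 := Real.exp_one_gt_d9
      calc (2:ℝ)^11 ≤ (2.7182818283:ℝ)^8 := by norm_num
        _ ≤ Real.exp 1 ^ 8 := by gcongr
        _ = Real.exp 8 := by rw [← Real.exp_nat_mul]; norm_num
    calc _ ≤ 2 ^ (3 * t0) * (1 / 2 ^ 11) ^ t0 := by
          gcongr
          refine h5.trans ?_
          gcongr
      _ = ((2:ℝ)^3 * (1/2^11))^t0 := by rw [pow_mul, ← mul_pow]
      _ = (1 / 2) ^ (8 * t0) := by rw [pow_mul]; norm_num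
  · refine (Pr_tri hq0 X t0).trans ?_
    have h4 := choose_le_exp (triX X).card t0
    have h5 : ((triX X).card : ℝ) ≤ 3 * (κ^2 * s^2) := by
      have := card_triX X
      rw [hM] at this
      have h6 : 3 * (X.card ^ 2 * s^2) ≤ 3 * (κ^2 * s^2) := by gcongr
      exact_mod_cast this.trans h6
    have ht0pos : (0:ℝ) < t0 := by exact_mod_cast ht00
    have h6 : 3 * ((triX X).card : ℝ) / t0 * (1 / (q:ℝ))^3 ≤ 1 / 2^8 := by
      calc 3 * ((triX X).card : ℝ) / t0 * (1 / (q:ℝ))^3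
          ≤ 3 * (3 * ((κ:ℝ)^2 * (s:ℝ)^2)) / t0 * (1 / (q:ℝ))^3 := by gcongr
        _ = 9 * 64 * ((s:ℝ)^2 / (q:ℝ)^2) := by rw [ht0R]; field_simp; ring
        _ = 9 * 64 / 512^2 := by rw [hq]; push_cast; field_simp
        _ ≤ _ := by norm_num
    calc _ ≤ (3 * ((triX X).card : ℝ) / t0) ^ t0 * (1 / (q:ℝ)) ^ (3 * t0) := by gcongr
      _ = (3 * ((triX X).card : ℝ) / t0 * (1 / (q:ℝ))^3) ^ t0 := by rw [pow_mul, ← mul_pow]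
      _ ≤ (1 / 2^8) ^ t0 := by gcongr
      _ = _ := by rw [pow_mul]; norm_num

end tri

end

end RTF


namespace RTF
open Finset
open scoped Classical

noncomputable section

section row
variable {M : Type} [Fintype M] {q : ℕ}

/-- number of zeros of `f` on `Y` -/
def zc (f : M → Fin q) (Y : Finset M) : ℕ := (Y.filter (fun y => (f y).val = 0)).card

lemma Pr_zero1 (hq : 0 < q) (E : Finset M) :
    Pr (fun a : M → Fin q => ∀ e ∈ E, (a e).val = 0) = (1 / (q:ℝ)) ^ E.card := by
  have : Nonempty (Fin q) := ⟨⟨0, hq⟩⟩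
  have := Pr_forall_mem (ι := M) E ({⟨0, hq⟩} : Finset (Fin q))
  simp only [card_singleton, Fintype.card_fin, mem_singleton, Nat.cast_one] at this
  rw [← this]
  congr 1
  funext a
  simp [Fin.ext_iff]

lemma Ex_zc_sq (hq : 0 < q) (Y : Finset M) :
    Ex (fun f : M → Fin q => (zc f Y : ℝ) ^ 2) ≤ (Y.card / q) ^ 2 + Y.card / q := by
  have hq' : (0:ℝ) < q := by exact_mod_cast hq
  have h1 : ∀ f : M → Fin q, (zc f Y : ℝ) ^ 2 =
      ∑ y ∈ Y, ∑ z ∈ Y, (if ∀ e ∈ ({y, z} : Finset M), (f e).val = 0 then (1:ℝ) else 0) := by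
    intro f
    have : (zc f Y : ℝ) = ∑ y ∈ Y, (if (f y).val = 0 then (1:ℝ) else 0) := by
      unfold zc; rw [card_filter]; push_cast; rfl
    rw [this, sq, sum_mul_sum]
    refine sum_congr rfl fun y _ => sum_congr rfl fun z _ => ?_
    simp only [mem_insert, mem_singleton, forall_eq_or_imp, forall_eq]
    by_cases h : (f y).val = 0 <;> by_cases h' : (f z).val = 0 <;> simp [h, h']
  simp only [h1]
  rw [Ex_sum]
  have h2 : ∀ y ∈ Y, Ex (fun f : M → Fin q => ∑ z ∈ Y,
      (if ∀ e ∈ ({y, z} : Finset M), (f e).val = 0 then (1:ℝ) else 0)) ≤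
      Y.card * (1 / q) ^ 2 + 1 / q := by
    intro y hy
    rw [Ex_sum]
    have h3 : ∀ z ∈ Y, Ex (fun f : M → Fin q =>
        (if ∀ e ∈ ({y, z} : Finset M), (f e).val = 0 then (1:ℝ) else 0)) ≤
        (1 / q) ^ 2 + if z = y then (1 / (q:ℝ)) else 0 := by
      intro z _
      rw [← Pr_eq_Ex, Pr_zero1 hq]
      by_cases h : z = y
      · subst h; simp
      · rw [card_pair (Ne.symm h)]; simp [h]
    refine (sum_le_sum h3).trans ?_
    rw [sum_add_distrib]
    simp [hy]
  refine (sum_le_sum h2).trans (le_of_eq ?_)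
  rw [sum_const, nsmul_eq_mul]
  ring

lemma Ex_zc_exp (hq : 0 < q) (Y : Finset M) (x : ℝ) (hx : 0 ≤ x) :
    Ex (fun f : M → Fin q => Real.exp (x * zc f Y)) ≤ Real.exp (Y.card / q * Real.exp x) := by
  have hq' : (0:ℝ) < q := by exact_mod_cast hq
  have : Nonempty (Fin q) := ⟨⟨0, hq⟩⟩
  have h1 : ∀ f : M → Fin q, Real.exp (x * zc f Y) =
      ∏ y ∈ Y, (if (f y).val = 0 then Real.exp x else 1) := by
    intro f
    rw [prod_ite]
    simp only [prod_const, one_pow, mul_one]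
    rw [← Real.exp_nat_mul]
    unfold zc
    rw [mul_comm]
  simp only [h1]
  rw [Ex_prod_mem (ι := M) Y (fun z : Fin q => if z.val = 0 then Real.exp x else 1), Ex_ite hq]
  have h2 : (1:ℝ) + (Real.exp x - 1) * (1 / q) ≤ Real.exp (1 / q * Real.exp x) := by
    have := Real.add_one_le_exp (1 / (q:ℝ) * Real.exp x)
    have : 0 < 1 / (q:ℝ) := by positivity
    nlinarith
  have h3 : (0:ℝ) ≤ 1 + (Real.exp x - 1) * (1 / q) := by
    have : 1 ≤ Real.exp x := Real.one_le_exp hx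
    have : 0 ≤ (Real.exp x - 1) * (1 / q) := mul_nonneg (by linarith) (by positivity)
    linarith
  calc _ ≤ (Real.exp (1 / q * Real.exp x)) ^ Y.card := by gcongr
    _ = _ := by rw [← Real.exp_nat_mul]; congr 1; ring

lemma exp_trunc (θ τ s : ℝ) (hθ : 0 ≤ θ) (hs : 0 < s) (hτ : θ / s * τ ^ 2 ≤ 1) (hτ0 : 0 ≤ τ)
    (d : ℝ) (hd : 0 ≤ d) (hds : d ≤ s) :
    Real.exp (θ / s * d ^ 2) ≤ 1 + 2 * (θ / s) * d ^ 2 + Real.exp (-(θ * τ)) * Real.exp (2 * θ * d) := by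
  have hz : 0 ≤ θ / s := by positivity
  rcases le_total d τ with h | h
  · have h1 : θ / s * d ^ 2 ≤ 1 := le_trans (by gcongr) hτ
    have h0 : 0 ≤ θ / s * d ^ 2 := by positivity
    have h2 := Real.abs_exp_sub_one_sub_id_le (x := θ / s * d ^ 2) (by rw [abs_of_nonneg h0]; exact h1)
    have h3 := (abs_le.1 h2).2
    have h4 : 0 ≤ Real.exp (-(θ * τ)) * Real.exp (2 * θ * d) := by positivity
    nlinarith
  · rw [← Real.exp_add]
    have : Real.exp (θ / s * d ^ 2) ≤ Real.exp (-(θ * τ) + 2 * θ * d) := by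
      apply Real.exp_le_exp.2
      have h1 : θ / s * d ^ 2 ≤ θ * d := by
        rw [div_mul_eq_mul_div, div_le_iff₀ hs]
        have : 0 ≤ θ * d := by positivity
        nlinarith
      have : θ * τ ≤ θ * d := by gcongr
      linarith
    have : 0 ≤ 2 * (θ / s) * d ^ 2 := by positivity
    linarith

/-- one row -/
lemma Ex_row (hq : 0 < q) (Y : Finset M) (θ τ s ε : ℝ) (hθ : 0 ≤ θ) (hs : 0 < s)
    (hε : Y.card / q * Real.exp (2 * θ) - θ * τ ≤ ε) :
    Ex (fun f : M → Fin q => 1 + 2 * (θ / s) * (zc f Y : ℝ) ^ 2 +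
        Real.exp (-(θ * τ)) * Real.exp (2 * θ * zc f Y)) ≤
      Real.exp (2 * (θ / s) * ((Y.card / q) ^ 2 + Y.card / q) + Real.exp ε) := by
  have : Nonempty (Fin q) := ⟨⟨0, hq⟩⟩
  rw [Ex_add, Ex_add, Ex_const, Ex_mul, Ex_mul]
  have h1 := Ex_zc_sq hq Y
  have h2 := Ex_zc_exp hq Y (2 * θ) (by positivity)
  have h3 : Real.exp (-(θ * τ)) * Ex (fun f : M → Fin q => Real.exp (2 * θ * zc f Y)) ≤ Real.exp ε := by
    calc _ ≤ Real.exp (-(θ * τ)) * Real.exp (Y.card / q * Real.exp (2 * θ)) := by gcongr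
      _ = Real.exp (Y.card / q * Real.exp (2 * θ) - θ * τ) := by rw [← Real.exp_add]; congr 1; ring
      _ ≤ _ := Real.exp_le_exp.2 hε
  have h4 : 2 * (θ / s) * Ex (fun f : M → Fin q => (zc f Y : ℝ) ^ 2) ≤
      2 * (θ / s) * ((Y.card / q) ^ 2 + Y.card / q) := by gcongr
  have := Real.add_one_le_exp (2 * (θ / s) * ((Y.card / q) ^ 2 + Y.card / q) + Real.exp ε)
  linarith

/-- all rows -/
lemma Pr_rows (hq : 0 < q) (Y : M → Finset M) (N : ℕ) (hN : ∀ w, (Y w).card ≤ N) (s : ℕ)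
    (θ τ ε Λ : ℝ) (hθ : 0 ≤ θ) (hs : 0 < s) (hτ : θ / s * τ ^ 2 ≤ 1) (hτ0 : 0 ≤ τ)
    (hε : N / q * Real.exp (2 * θ) - θ * τ ≤ ε) :
    Pr (fun a : M × M → Fin q => (∀ w, zc (fun y => a (w, y)) (Y w) ≤ s) ∧
        Λ ≤ ∑ w, (zc (fun y => a (w, y)) (Y w) : ℝ) ^ 2) ≤
      Real.exp (-(θ / s * Λ) + Fintype.card M * (2 * (θ / s) * ((N / q) ^ 2 + N / q) + Real.exp ε)) := by
  have hq' : (0:ℝ) < q := by exact_mod_cast hq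
  have hsR : (0:ℝ) < s := by exact_mod_cast hs
  have e1 := Pr_equiv (Equiv.curry M M (Fin q)) (fun a : M → M → Fin q =>
      (∀ w, zc (a w) (Y w) ≤ s) ∧ Λ ≤ ∑ w, (zc (a w) (Y w) : ℝ) ^ 2)
  have e2 : Pr (fun a : M × M → Fin q => (∀ w, zc (fun y => a (w, y)) (Y w) ≤ s) ∧
        Λ ≤ ∑ w, (zc (fun y => a (w, y)) (Y w) : ℝ) ^ 2) =
      Pr (fun a : M → M → Fin q =>
      (∀ w, zc (a w) (Y w) ≤ s) ∧ Λ ≤ ∑ w, (zc (a w) (Y w) : ℝ) ^ 2) := by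
    rw [← e1]; rfl
  rw [e2]
  set g : M → (M → Fin q) → ℝ := fun w f => 1 + 2 * (θ / s) * (zc f (Y w) : ℝ) ^ 2 +
        Real.exp (-(θ * τ)) * Real.exp (2 * θ * zc f (Y w)) with hg
  have hg0 : ∀ w f, 0 ≤ g w f := by intro w f; simp only [hg]; positivity
  have h1 : Pr (fun a : M → M → Fin q =>
      (∀ w, zc (a w) (Y w) ≤ s) ∧ Λ ≤ ∑ w, (zc (a w) (Y w) : ℝ) ^ 2) ≤
      Ex (fun a : M → M → Fin q => Real.exp (-(θ / s * Λ)) * ∏ w, g w (a w)) := by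
    refine Pr_le_Ex ?_ ?_
    · intro a
      exact mul_nonneg (by positivity) (prod_nonneg fun w _ => hg0 _ _)
    · rintro a ⟨ha1, ha2⟩
      have h2 : Real.exp (θ / s * ∑ w, (zc (a w) (Y w) : ℝ) ^ 2) ≤ ∏ w, g w (a w) := by
        rw [mul_sum, Real.exp_sum]
        refine prod_le_prod (fun _ _ => by positivity) fun w _ => ?_
        exact exp_trunc θ τ s hθ hsR hτ hτ0 _ (by positivity) (by exact_mod_cast ha1 w)
      calc (1:ℝ) = Real.exp (-(θ / s * Λ)) * Real.exp (θ / s * Λ) := by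
            rw [← Real.exp_add]; simp
        _ ≤ Real.exp (-(θ / s * Λ)) * Real.exp (θ / s * ∑ w, (zc (a w) (Y w) : ℝ) ^ 2) := by
            gcongr
        _ ≤ _ := by gcongr
  refine h1.trans ?_
  rw [Ex_mul, Ex_prod, Real.exp_add]
  gcongr
  have h3 : ∀ w, Ex (g w) ≤ Real.exp (2 * (θ / s) * ((N / q) ^ 2 + N / q) + Real.exp ε) := by
    intro w
    have hc : ((Y w).card : ℝ) / q ≤ N / q := by
      have := hN w
      gcongr
    refine (Ex_row hq (Y w) θ τ s ε hθ hsR ?_).trans ?_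
    · refine le_trans ?_ hε
      gcongr
    · apply Real.exp_le_exp.2
      gcongr
  calc _ ≤ ∏ w : M, Real.exp (2 * (θ / s) * ((N / q) ^ 2 + N / q) + Real.exp ε) :=
        prod_le_prod (fun w _ => Ex_nonneg (hg0 w)) fun w _ => h3 w
    _ = _ := by
      rw [prod_const, ← Real.exp_nat_mul, card_univ]

lemma Pr_cols (hq : 0 < q) (Y : M → Finset M) (N : ℕ) (hN : ∀ w, (Y w).card ≤ N) (s : ℕ)
    (θ τ ε Λ : ℝ) (hθ : 0 ≤ θ) (hs : 0 < s) (hτ : θ / s * τ ^ 2 ≤ 1) (hτ0 : 0 ≤ τ)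
    (hε : N / q * Real.exp (2 * θ) - θ * τ ≤ ε) :
    Pr (fun a : M × M → Fin q => (∀ w, zc (fun y => a (y, w)) (Y w) ≤ s) ∧
        Λ ≤ ∑ w, (zc (fun y => a (y, w)) (Y w) : ℝ) ^ 2) ≤
      Real.exp (-(θ / s * Λ) + Fintype.card M * (2 * (θ / s) * ((N / q) ^ 2 + N / q) + Real.exp ε)) := by
  refine le_trans (le_of_eq ?_) (Pr_rows hq Y N hN s θ τ ε Λ hθ hs hτ hτ0 hε)
  exact Pr_equiv (Equiv.arrowCongr (Equiv.prodComm M M) (Equiv.refl (Fin q))) (fun a : M × M → Fin q =>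
    (∀ w, zc (fun y => a (w, y)) (Y w) ≤ s) ∧
        Λ ≤ ∑ w, (zc (fun y => a (w, y)) (Y w) : ℝ) ^ 2)

end row

end

end RTF


namespace RTF
open Finset
open scoped Classical

noncomputable section

section good
variable {M : Type} [Fintype M] [LinearOrder M] {q : ℕ}

/-- number of neighbours of `w` in `Y` -/
def dd (a : M × M → Fin q) (Y : Finset M) (w : M) : ℕ :=
  (Y.filter (fun y => y ≠ w ∧ (a (ed w y)).val = 0)).card

lemma dd_mono (a : M × M → Fin q) {Y Z : Finset M} (h : Y ⊆ Z) (w : M) : dd a Y w ≤ dd a Z w :=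
  card_le_card (filter_subset_filter _ h)

lemma dd_split (a : M × M → Fin q) (Y : Finset M) (w : M) :
    dd a Y w = zc (fun y => a (w, y)) (Y.filter (fun y => w < y)) +
      zc (fun y => a (y, w)) (Y.filter (fun y => y < w)) := by
  unfold dd zc
  rw [← card_union_of_disjoint]
  · congr 1
    ext y
    simp only [mem_filter, mem_union]
    unfold ed
    rcases lt_trichotomy y w with h | h | h
    · simp [h, h.ne, h.le, h.not_gt]
    · simp [h]
    · simp [h, h.ne', h.le, h.not_gt]
  · rw [disjoint_left]
    intro y hy hy'
    simp only [mem_filter] at hy hy'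
    exact lt_asymm hy.1.2 hy'.1.2

lemma Pr_deg (hq : 0 < q) (s : ℕ) (hs : 0 < s) (hM : Fintype.card M = s ^ 2) (hqs : q = 512 * s) :
    Pr (fun a : M × M → Fin q => ∃ i ∈ (univ : Finset M), s ≤ dd a univ i) ≤ s ^ 2 * (3 / 512) ^ s := by
  have h := Pr_biUnion_le (Ω := M × M → Fin q) (univ : Finset M) (fun i a => s ≤ dd a univ i)
    ((3 / 512) ^ s) ?_
  · rw [card_univ, hM] at h
    exact_mod_cast h
  intro i _
  have hq' : (0:ℝ) < q := by exact_mod_cast hq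
  have hsR : (0:ℝ) < s := by exact_mod_cast hs
  have h1 : Pr (fun a : M × M → Fin q => s ≤ dd a univ i) ≤
      Pr (fun a : M × M → Fin q => ∃ J ∈ powersetCard s (univ : Finset M),
        ∀ e ∈ J.image (ed i), (a e).val = 0) := by
    refine Pr_mono fun a ha => ?_
    obtain ⟨L, hL, hLc⟩ := exists_subset_card_eq ha
    refine ⟨L, mem_powersetCard.2 ⟨subset_univ _, hLc⟩, ?_⟩
    intro e he
    obtain ⟨y, hy, rfl⟩ := mem_image.1 he
    exact (mem_filter.1 (hL hy)).2.2
  have h2 := Pr_biUnion_le (Ω := M × M → Fin q) (powersetCard s (univ : Finset M))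
    (fun J a => ∀ e ∈ J.image (ed i), (a e).val = 0) ((1 / q) ^ s) ?_
  · refine h1.trans (h2.trans ?_)
    rw [card_powersetCard, card_univ, hM]
    have h3 := choose_le_exp (s ^ 2) s
    calc _ ≤ (3 * ((s ^ 2 : ℕ):ℝ) / s) ^ s * (1 / (q:ℝ)) ^ s := by gcongr
      _ = (3 * ((s ^ 2 : ℕ):ℝ) / s * (1 / (q:ℝ))) ^ s := by rw [mul_pow]
      _ = _ := by
        congr 1
        rw [hqs]; push_cast; field_simp
  · intro J hJ
    rw [Pr_zero hq, card_image_of_injective, (mem_powersetCard.1 hJ).2]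
    intro y z h
    rw [ed_eq_iff] at h
    rcases h with h | h
    · exact h.2
    · rw [h.2, h.1]

lemma Pr_le_of_or {Ω : Type*} [Fintype Ω] {P Q R : Ω → Prop} {x y : ℝ} (h : ∀ ω, P ω → Q ω ∨ R ω)
    (hQ : Pr Q ≤ x) (hR : Pr R ≤ y) : Pr P ≤ x + y :=
  (Pr_mono h).trans ((Pr_or Q R).trans (add_le_add hQ hR))

/-- numeric core -/
lemma num_core (s b N q m : ℝ) (hs : 0 < s) (hb : 0 < b) (hN : 0 ≤ N) (hq : q = 512 * s)
    (hm : m = s ^ 2) (ε : ℝ) (hε : m * Real.exp ε ≤ 1) :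
    -((b / 100) / s * ((N + 2 ^ 17 * s) ^ 2 / 128)) +
      m * (2 * ((b / 100) / s) * ((N / q) ^ 2 + N / q) + Real.exp ε) ≤
      1 - 5 * b * (N + 2 ^ 17 * s) := by
  have h1 : m * (2 * ((b / 100) / s) * ((N / q) ^ 2 + N / q)) =
      b / s * (2 / 100 * (N ^ 2 / 512 ^ 2 + N * s / 512)) := by
    rw [hm, hq]; field_simp
  have h2 : 5 * b * (N + 2 ^ 17 * s) = b / s * (5 * s * (N + 2 ^ 17 * s)) := by
    field_simp
  have h3 : (b / 100) / s * ((N + 2 ^ 17 * s) ^ 2 / 128) =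
      b / s * ((N + 2 ^ 17 * s) ^ 2 / 12800) := by ring
  have h4 : 2 / 100 * (N ^ 2 / 512 ^ 2 + N * s / 512) + (5 * s * (N + 2 ^ 17 * s)) ≤
      (N + 2 ^ 17 * s) ^ 2 / 12800 := by
    nlinarith [mul_nonneg hN hs.le, sq_nonneg N, sq_nonneg s]
  have h5 : b / s * (2 / 100 * (N ^ 2 / 512 ^ 2 + N * s / 512) + (5 * s * (N + 2 ^ 17 * s))) ≤
      b / s * ((N + 2 ^ 17 * s) ^ 2 / 12800) := by gcongr
  rw [mul_add, h1, h2, h3]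
  rw [mul_add] at h5
  linarith

lemma Pr_fix_aux (s : ℕ) (Y : Finset M) (Λ B : ℝ)
    (hR' : Pr (fun a : M × M → Fin q => (∀ w, zc (fun y => a (w, y)) (Y.filter (fun y => w < y)) ≤ s) ∧
        Λ ≤ ∑ w, (zc (fun y => a (w, y)) (Y.filter (fun y => w < y)) : ℝ) ^ 2) ≤ B)
    (hC' : Pr (fun a : M × M → Fin q => (∀ w, zc (fun y => a (y, w)) (Y.filter (fun y => y < w)) ≤ s) ∧
        Λ ≤ ∑ w, (zc (fun y => a (y, w)) (Y.filter (fun y => y < w)) : ℝ) ^ 2) ≤ B) :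
    Pr (fun a : M × M → Fin q => (∀ w, dd a univ w ≤ s) ∧
        4 * Λ < ∑ w, (dd a Y w : ℝ) ^ 2) ≤ 2 * B := by
  refine le_trans (Pr_le_of_or ?_ hR' hC') (two_mul _).ge
  rintro a ⟨h1, h2⟩
  by_contra hcon
  rw [not_or, not_and_or, not_and_or] at hcon
  have hle : ∀ w, dd a Y w ≤ s := fun w => (dd_mono a (subset_univ _) w).trans (h1 w)
  have hsp := dd_split a Y
  have ha : ∀ w, zc (fun y => a (w, y)) (Y.filter (fun y => w < y)) ≤ s := fun w => by
    have := hle w; rw [hsp] at this; omega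
  have hb' : ∀ w, zc (fun y => a (y, w)) (Y.filter (fun y => y < w)) ≤ s := fun w => by
    have := hle w; rw [hsp] at this; omega
  have h3 := hcon.1.resolve_left (fun h => h ha)
  have h4 := hcon.2.resolve_left (fun h => h hb')
  push Not at h3 h4
  have h5 : ∑ w, (dd a Y w : ℝ) ^ 2 ≤
      ∑ w, (2 * (zc (fun y => a (w, y)) (Y.filter (fun y => w < y)) : ℝ) ^ 2 +
        2 * (zc (fun y => a (y, w)) (Y.filter (fun y => y < w)) : ℝ) ^ 2) := by
    refine sum_le_sum fun w _ => ?_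
    rw [hsp]; push_cast
    nlinarith [sq_nonneg ((zc (fun y => a (w, y)) (Y.filter (fun y => w < y)) : ℝ) -
      zc (fun y => a (y, w)) (Y.filter (fun y => y < w)))]
  rw [sum_add_distrib, ← mul_sum, ← mul_sum] at h5
  linarith

/-- bounds for fixed `Y` -/
lemma Pr_fixedY (hq : 0 < q) (s b : ℕ) (hs : 0 < s) (hb : 0 < b) (hM : Fintype.card M = s ^ 2)
    (hqs : q = 512 * s) (hsb : s ^ 2 ≤ 2 ^ b)
    (H1 : (b:ℝ) / 100 * Real.exp (b / 10) ≤ s)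
    (H2 : 2048 * b * Real.exp (b / 50) + b ≤ (b:ℝ) / 100 * Real.exp (b / 20))
    (Y : Finset M) (hY : Y.card ≤ 2 ^ 20 * s * b) :
    Pr (fun a : M × M → Fin q => (∀ w, dd a univ w ≤ s) ∧
        ((Y.card:ℝ) + 2 ^ 17 * s) ^ 2 / 32 < ∑ w, (dd a Y w : ℝ) ^ 2) ≤
      2 * Real.exp (1 - 5 * b * (Y.card + 2 ^ 17 * s)) := by
  have hq' : (0:ℝ) < q := by exact_mod_cast hq
  have hsR : (0:ℝ) < s := by exact_mod_cast hs
  have hbR : (0:ℝ) < b := by exact_mod_cast hb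
  obtain ⟨Λ, hΛ⟩ : ∃ Λ : ℝ, Λ = ((Y.card:ℝ) + 2 ^ 17 * s) ^ 2 / 128 := ⟨_, rfl⟩
  have hτ : (b:ℝ) / 100 / s * (Real.exp (b / 20)) ^ 2 ≤ 1 := by
    rw [← Real.exp_nat_mul, div_mul_eq_mul_div, div_le_one hsR]
    refine le_trans (le_of_eq ?_) H1
    congr 2; push_cast; ring
  have hε : (Y.card : ℝ) / q * Real.exp (2 * (b / 100)) - b / 100 * Real.exp (b / 20) ≤ -b := by
    have h1 : (Y.card : ℝ) / q ≤ 2048 * b := by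
      rw [div_le_iff₀ hq', hqs]
      have : (Y.card : ℝ) ≤ 2 ^ 20 * s * b := by exact_mod_cast hY
      push_cast
      linarith
    have h2 : (Y.card : ℝ) / q * Real.exp (2 * (b / 100)) ≤ 2048 * b * Real.exp (b / 50) := by
      rw [show (2 * ((b:ℝ) / 100)) = b / 50 by ring]
      gcongr
    linarith
  have hm : (Fintype.card M : ℝ) * Real.exp (-b) ≤ 1 := by
    rw [Real.exp_neg, ← div_eq_mul_inv, div_le_one (Real.exp_pos _), hM]
    calc ((s ^ 2 : ℕ) : ℝ) ≤ ((2 ^ b : ℕ) : ℝ) := by exact_mod_cast hsb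
      _ = 2 ^ b := by push_cast; rfl
      _ ≤ (Real.exp 1) ^ b := by
        gcongr
        linarith [Real.exp_one_gt_d9]
      _ = _ := by rw [← Real.exp_nat_mul, mul_one]
  have hnum := num_core s b Y.card q (Fintype.card M) hsR hbR (by positivity) (by rw [hqs]; push_cast; rfl)
    (by rw [hM]; push_cast; rfl) (-b) hm
  rw [← hΛ] at hnum
  have hR := Pr_rows hq (fun w => Y.filter (fun y => w < y)) Y.card (fun w => card_filter_le _ _) s
    (b / 100) (Real.exp (b / 20)) (-b) Λ (by positivity) hs hτ (by positivity) hε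
  have hC := Pr_cols hq (fun w => Y.filter (fun y => y < w)) Y.card (fun w => card_filter_le _ _) s
    (b / 100) (Real.exp (b / 20)) (-b) Λ (by positivity) hs hτ (by positivity) hε
  have hB := Real.exp_le_exp.2 hnum
  clear hnum hm hε hτ H1 H2 hsb
  have h := Pr_fix_aux (q := q) s Y Λ _ (by convert hR) (by convert hC)
  have e : 4 * Λ = ((Y.card:ℝ) + 2 ^ 17 * s) ^ 2 / 32 := by rw [hΛ]; ring
  rw [e] at h
  refine h.trans ?_
  exact mul_le_mul_of_nonneg_left hB (by norm_num)

def Good (s b : ℕ) (a : M × M → Fin q) : Prop :=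
  (∀ w, dd a univ w ≤ s) ∧ ∀ Y : Finset M, Y.card ≤ 2 ^ 20 * s * b →
    ∑ w, (dd a Y w : ℝ) ^ 2 ≤ ((Y.card:ℝ) + 2 ^ 17 * s) ^ 2 / 32

lemma Pr_good (s b : ℕ) (hs : 64 ≤ s) (hb : 0 < b) (hM : Fintype.card M = s ^ 2)
    (hqs : q = 512 * s) (hsb : s ^ 2 ≤ 2 ^ b)
    (H1 : (b:ℝ) / 100 * Real.exp (b / 10) ≤ s)
    (H2 : 2048 * b * Real.exp (b / 50) + b ≤ (b:ℝ) / 100 * Real.exp (b / 20)) :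
    Pr (fun a : M × M → Fin q => ¬ Good s b a) ≤ 1 / 8 := by
  have hq : 0 < q := by omega
  have hs0 : 0 < s := by omega
  have hbR : (1:ℝ) ≤ b := by exact_mod_cast hb
  have hsR : (64:ℝ) ≤ s := by exact_mod_cast hs
  have h1 : Pr (fun a : M × M → Fin q => ¬ Good s b a) ≤
      Pr (fun a : M × M → Fin q => ∃ i ∈ (univ : Finset M), s ≤ dd a univ i) +
      Pr (fun a : M × M → Fin q => ∃ Y ∈ (univ : Finset M).powerset, Y.card ≤ 2 ^ 20 * s * b ∧
        (∀ w, dd a univ w ≤ s) ∧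
        ((Y.card:ℝ) + 2 ^ 17 * s) ^ 2 / 32 < ∑ w, (dd a Y w : ℝ) ^ 2) := by
    refine le_trans (Pr_mono ?_) (Pr_or _ _)
    intro a ha
    by_contra hcon
    push Not at hcon
    obtain ⟨h1, h2⟩ := hcon
    have h3 : ∀ w, dd a univ w ≤ s := fun w => (h1 w (mem_univ _)).le
    exact ha ⟨h3, fun Y hY => h2 Y (by simp) hY h3⟩
  refine h1.trans ?_
  have h2 := Pr_deg (M := M) hq s hs0 hM hqs
  have h3 : (s:ℝ) ^ 2 * (3 / 512) ^ s ≤ 1 / 16 := by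
    have e1 : (s:ℝ) ≤ 2 ^ s := by exact_mod_cast Nat.lt_two_pow_self.le
    calc (s:ℝ) ^ 2 * (3 / 512) ^ s ≤ (2 ^ s) ^ 2 * (3 / 512) ^ s := by gcongr
      _ = (2 ^ 2 * (3 / 512)) ^ s := by rw [mul_pow, ← pow_mul, ← pow_mul, mul_comm s 2]
      _ ≤ (1/16) ^ s := by gcongr; norm_num
      _ ≤ (1/16) ^ 1 := pow_le_pow_of_le_one (by norm_num) (by norm_num) (by omega)
      _ = _ := by norm_num
  have h4 : Pr (fun a : M × M → Fin q => ∃ Y ∈ (univ : Finset M).powerset, Y.card ≤ 2 ^ 20 * s * b ∧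
        (∀ w, dd a univ w ≤ s) ∧
        ((Y.card:ℝ) + 2 ^ 17 * s) ^ 2 / 32 < ∑ w, (dd a Y w : ℝ) ^ 2) ≤
      ∑ Y ∈ (univ : Finset M).powerset, 2 * Real.exp (1 - 5 * b * (Y.card + 2 ^ 17 * s)) := by
    refine (Pr_biUnion _ _).trans (sum_le_sum fun Y _ => ?_)
    by_cases hY : Y.card ≤ 2 ^ 20 * s * b
    · exact (Pr_mono fun a h => h.2).trans (Pr_fixedY hq s b hs0 hb hM hqs hsb H1 H2 Y hY)
    · refine (Pr_mono (Q := fun _ => False) fun a h => hY h.1).trans ?_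
      simp [Pr]; positivity
  have h5 : ∑ Y ∈ (univ : Finset M).powerset, 2 * Real.exp (1 - 5 * b * (Y.card + 2 ^ 17 * s)) =
      2 * Real.exp (1 - 5 * b * (2 ^ 17 * s)) * (Real.exp (-(5 * b)) + 1) ^ (Fintype.card M) := by
    have := Finset.sum_pow_mul_eq_add_pow (Real.exp (-(5 * b))) 1 (univ : Finset M)
    rw [card_univ] at this
    rw [← this, mul_sum]
    refine sum_congr rfl fun Y _ => ?_
    rw [one_pow, mul_one, ← Real.exp_nat_mul, mul_assoc 2 (Real.exp _) (Real.exp _), ← Real.exp_add]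
    congr 2; ring
  have h6 : (Real.exp (-(5 * b)) + 1) ^ (Fintype.card M) ≤ Real.exp 1 := by
    calc _ ≤ (Real.exp (Real.exp (-(5 * b)))) ^ (Fintype.card M) := by
          gcongr
          exact Real.add_one_le_exp _
      _ = Real.exp (Fintype.card M * Real.exp (-(5 * b))) := by rw [Real.exp_nat_mul]
      _ ≤ _ := by
        apply Real.exp_le_exp.2
        rw [Real.exp_neg, ← div_eq_mul_inv, div_le_one (Real.exp_pos _), hM]
        calc ((s ^ 2 : ℕ) : ℝ) ≤ ((2 ^ b : ℕ) : ℝ) := by exact_mod_cast hsb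
          _ = 2 ^ b := by push_cast; rfl
          _ ≤ (Real.exp 5) ^ b := by
            gcongr
            linarith [Real.add_one_le_exp (5:ℝ)]
          _ = _ := by rw [← Real.exp_nat_mul, mul_comm]
  have h7 : 2 * Real.exp (1 - 5 * b * (2 ^ 17 * s)) * (Real.exp (-(5 * b)) + 1) ^ (Fintype.card M) ≤
      1 / 16 := by
    calc _ ≤ 2 * Real.exp (1 - 5 * b * (2 ^ 17 * s)) * Real.exp 1 := by gcongr
      _ = 2 * Real.exp (2 - 5 * b * (2 ^ 17 * s)) := by
        rw [mul_assoc, ← Real.exp_add]; congr 2; ring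
      _ ≤ 2 * Real.exp (-64) := by
        gcongr
        nlinarith
      _ ≤ 2 * (1 / 32) := by
        gcongr
        rw [Real.exp_neg, one_div]
        apply inv_anti₀ (by norm_num)
        linarith [Real.add_one_le_exp (64:ℝ)]
      _ = _ := by norm_num
  calc _ ≤ (1/16:ℝ) + 1/16 := add_le_add (h2.trans h3) (h4.trans (h5.le.trans h7))
    _ = _ := by norm_num

end good

end

end RTF


namespace RTF
open Finset
open scoped Classical

noncomputable section

lemma Pr_fib {V M : Type} [Fintype V] [Fintype M] (s b : ℕ) (hs : 0 < s) (hb : 0 < b)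
    (hM : Fintype.card M = s ^ 2) (hV : Fintype.card V = s ^ 2 * b) (hsb : s ^ 2 ≤ 2 ^ b) :
    Pr (fun y : V → M => ∃ j ∈ (univ : Finset M),
      8 * b ≤ (univ.filter (fun v => y v = j)).card) ≤ 1 / 4 := by
  have hsR : (0:ℝ) < s := by exact_mod_cast hs
  have hbR : (0:ℝ) < b := by exact_mod_cast hb
  have hne : Nonempty M := by
    rw [← Fintype.card_pos_iff, hM]; positivity
  have h1 : ∀ j ∈ (univ : Finset M), Pr (fun y : V → M => 8 * b ≤ (univ.filter (fun v => y v = j)).card) ≤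
      (3 / 8) ^ (8 * b) := by
    intro j _
    have h2 : Pr (fun y : V → M => 8 * b ≤ (univ.filter (fun v => y v = j)).card) ≤
        Pr (fun y : V → M => ∃ L ∈ powersetCard (8 * b) (univ : Finset V), ∀ v ∈ L, y v ∈ ({j} : Finset M)) := by
      refine Pr_mono fun y hy => ?_
      obtain ⟨L, hL, hLc⟩ := exists_subset_card_eq hy
      refine ⟨L, mem_powersetCard.2 ⟨subset_univ _, hLc⟩, fun v hv => ?_⟩
      simpa using hL hv
    have h3 := Pr_biUnion_le (Ω := V → M) (powersetCard (8 * b) (univ : Finset V))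
      (fun L y => ∀ v ∈ L, y v ∈ ({j} : Finset M)) ((1 / (s:ℝ) ^ 2) ^ (8 * b)) (by
        intro L hL
        rw [Pr_forall_mem, card_singleton, hM, (mem_powersetCard.1 hL).2]
        push_cast; rfl)
    refine h2.trans (h3.trans ?_)
    rw [card_powersetCard, card_univ, hV]
    have h4 := choose_le_exp (s ^ 2 * b) (8 * b)
    calc _ ≤ (3 * ((s ^ 2 * b : ℕ):ℝ) / ((8 * b : ℕ) : ℝ)) ^ (8 * b) * (1 / (s:ℝ) ^ 2) ^ (8 * b) := by gcongr
      _ = (3 * ((s ^ 2 * b : ℕ):ℝ) / ((8 * b : ℕ) : ℝ) * (1 / (s:ℝ) ^ 2)) ^ (8 * b) := by rw [mul_pow]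
      _ = _ := by
        congr 1
        push_cast; field_simp
  refine (Pr_biUnion_le _ _ _ h1).trans ?_
  rw [card_univ, hM]
  calc ((s ^ 2 : ℕ) : ℝ) * (3 / 8) ^ (8 * b) ≤ ((2 ^ b : ℕ) : ℝ) * (3 / 8) ^ (8 * b) := by gcongr
    _ = (2 * (3 / 8) ^ 8) ^ b := by push_cast; rw [mul_pow, pow_mul]
    _ ≤ (1 / 4) ^ b := by gcongr; norm_num
    _ ≤ (1 / 4) ^ 1 := pow_le_pow_of_le_one (by norm_num) (by norm_num) hb
    _ = _ := by norm_num

lemma Pr_spread {V M : Type} [Fintype V] [Fintype M] (s b κ : ℕ) (hs : 0 < s) (hb : 0 < b)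
    (hM : Fintype.card M = s ^ 2) (hsb : s ^ 2 ≤ 2 ^ b)
    (hκ : κ = 2 ^ 20 * s * b) (H3 : 4 * 2 ^ (3 * b) * (2 ^ 20 * b) ^ 16 ≤ s ^ 16)
    (x : V → M) (hx : ∀ X : Finset M, (univ.filter (fun v => x v ∈ X)).card ≤ b * X.card) :
    Pr (fun y : V → M => ∃ X ∈ powersetCard κ (univ : Finset M), ∃ Y ∈ powersetCard κ (univ : Finset M),
      ∃ S ∈ powersetCard (16 * κ) (univ.filter (fun v => x v ∈ X)), ∀ v ∈ S, y v ∈ Y) ≤ 1 / 4 := by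
  have hsR : (0:ℝ) < s := by exact_mod_cast hs
  have hbR : (0:ℝ) < b := by exact_mod_cast hb
  have hne : Nonempty M := by
    rw [← Fintype.card_pos_iff, hM]; positivity
  have hκ0 : 0 < κ := by rw [hκ]; positivity
  set p : ℝ := (2 ^ 20 * b / s) with hp
  have h1 : ∀ X ∈ powersetCard κ (univ : Finset M), ∀ Y ∈ powersetCard κ (univ : Finset M),
      ∀ S ∈ powersetCard (16 * κ) (univ.filter (fun v => x v ∈ X)),
      Pr (fun y : V → M => ∀ v ∈ S, y v ∈ Y) ≤ p ^ (16 * κ) := by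
    intro X hX Y hY S hS
    rw [Pr_forall_mem, hM, (mem_powersetCard.1 hS).2, (mem_powersetCard.1 hY).2]
    apply le_of_eq
    have e : (κ:ℝ) / ((s ^ 2 : ℕ) : ℝ) = p := by
      have : (κ:ℝ) = 2 ^ 20 * s * b := by rw [hκ]; push_cast; ring
      rw [hp, this]; push_cast; field_simp
    rw [e]
  have hch : (((powersetCard κ (univ : Finset M)).card : ℕ) : ℝ) ≤ (2 ^ b) ^ κ := by
    rw [card_powersetCard, card_univ, hM]
    have : (s ^ 2).choose κ ≤ (2 ^ b) ^ κ := (Nat.choose_le_pow _ _).trans (Nat.pow_le_pow_left hsb _)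
    exact_mod_cast this
  have hp0 : 0 ≤ p := by positivity
  have h2 : ∀ X ∈ powersetCard κ (univ : Finset M), ∀ Y ∈ powersetCard κ (univ : Finset M),
      Pr (fun y : V → M => ∃ S ∈ powersetCard (16 * κ) (univ.filter (fun v => x v ∈ X)),
        ∀ v ∈ S, y v ∈ Y) ≤ (2 ^ b) ^ κ * p ^ (16 * κ) := by
    intro X hX Y hY
    refine (Pr_biUnion_le _ _ _ (h1 X hX Y hY)).trans ?_
    gcongr
    have e1 : (powersetCard (16 * κ) (univ.filter (fun v => x v ∈ X))).card ≤ 2 ^ (b * κ) := by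
      rw [card_powersetCard]
      refine (Nat.choose_le_two_pow _ _).trans ?_
      apply Nat.pow_le_pow_right (by norm_num)
      have := hx X
      rw [(mem_powersetCard.1 hX).2] at this
      exact this
    rw [← pow_mul]
    exact_mod_cast e1
  have h3 : ∀ X ∈ powersetCard κ (univ : Finset M),
      Pr (fun y : V → M => ∃ Y ∈ powersetCard κ (univ : Finset M),
        ∃ S ∈ powersetCard (16 * κ) (univ.filter (fun v => x v ∈ X)),
        ∀ v ∈ S, y v ∈ Y) ≤ (2 ^ b) ^ κ * ((2 ^ b) ^ κ * p ^ (16 * κ)) := by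
    intro X hX
    refine (Pr_biUnion_le _ _ _ (h2 X hX)).trans ?_
    gcongr
  refine (Pr_biUnion_le _ _ _ h3).trans ?_
  calc _ ≤ (2 ^ b) ^ κ * ((2 ^ b) ^ κ * ((2 ^ b) ^ κ * p ^ (16 * κ))) := by gcongr
    _ = (2 ^ (3 * b) * p ^ 16) ^ κ := by
      rw [pow_mul p, ← mul_pow, ← mul_pow, ← mul_pow]; congr 1; ring
    _ ≤ (1 / 4) ^ κ := by
      gcongr
      have : (4:ℝ) * 2 ^ (3 * b) * (2 ^ 20 * b) ^ 16 ≤ s ^ 16 := by exact_mod_cast H3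
      rw [hp, div_pow, ← mul_div_assoc, div_le_iff₀ (by positivity)]
      linarith
    _ ≤ (1 / 4) ^ 1 := pow_le_pow_of_le_one (by norm_num) (by norm_num) hκ0
    _ = _ := by norm_num

lemma exists_y {V M : Type} [Fintype V] [Fintype M] (s b κ : ℕ) (hs : 0 < s) (hb : 0 < b)
    (hM : Fintype.card M = s ^ 2) (hV : Fintype.card V = s ^ 2 * b) (hsb : s ^ 2 ≤ 2 ^ b)
    (hκ : κ = 2 ^ 20 * s * b) (H3 : 4 * 2 ^ (3 * b) * (2 ^ 20 * b) ^ 16 ≤ s ^ 16)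
    (x : V → M) (hx : ∀ X : Finset M, (univ.filter (fun v => x v ∈ X)).card ≤ b * X.card) :
    ∃ y : V → M, (∀ j, (univ.filter (fun v => y v = j)).card ≤ 8 * b) ∧
      ∀ S : Finset V, 16 * κ ≤ S.card → κ < (S.image x).card ∨ κ < (S.image y).card := by
  have hne : Nonempty M := by
    rw [← Fintype.card_pos_iff, hM]; positivity
  have h1 := Pr_le_of_or (P := fun y : V → M => _ ∨ _) (fun _ h => h)
    (Pr_fib (V := V) (M := M) s b hs hb hM hV hsb) (Pr_spread s b κ hs hb hM hsb hκ H3 x hx)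
  obtain ⟨y, hy⟩ := exists_not_of_Pr (h1.trans_lt (by norm_num))
  rw [not_or] at hy
  obtain ⟨hy1, hy2⟩ := hy
  refine ⟨y, fun j => ?_, fun S hS => ?_⟩
  · by_contra hcon
    exact hy1 ⟨j, mem_univ _, by omega⟩
  · by_contra hcon
    push Not at hcon
    apply hy2
    have hκm : κ ≤ (univ : Finset M).card := by
      rw [card_univ, hM, hκ]
      have h2 : (2 ^ 20 * b) ^ 16 ≤ s ^ 16 := by
        refine le_trans ?_ H3
        apply Nat.le_mul_of_pos_left; positivity
      have h3 : 2 ^ 20 * b ≤ s := (Nat.pow_le_pow_iff_left (by norm_num)).1 h2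
      nlinarith
    obtain ⟨T, hT, hTc⟩ := exists_subset_card_eq hS
    obtain ⟨X, hX1, -, hX3⟩ := exists_subsuperset_card_eq (subset_univ (S.image x)) hcon.1 hκm
    obtain ⟨Y, hY1, -, hY3⟩ := exists_subsuperset_card_eq (subset_univ (S.image y)) hcon.2 hκm
    refine ⟨X, mem_powersetCard.2 ⟨subset_univ _, hX3⟩, Y, mem_powersetCard.2 ⟨subset_univ _, hY3⟩, T,
      mem_powersetCard.2 ⟨fun v hv => ?_, hTc⟩, fun v hv => hY1 (mem_image_of_mem _ (hT hv))⟩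
    simp only [mem_filter, mem_univ, true_and]
    exact hX1 (mem_image_of_mem _ (hT hv))

/-- labels making a bounded-to-one map injective -/
lemma exists_label {V M : Type} [Fintype V] (y : V → M) (k : ℕ)
    (h : ∀ j, (univ.filter (fun v => y v = j)).card ≤ k) :
    ∃ ρ : V → Fin k, ∀ u v, y u = y v → ρ u = ρ v → u = v := by
  have h1 : ∀ j : M, ∃ f : (univ.filter (fun v => y v = j) : Finset V) → Fin k, Function.Injective f := by
    intro j
    have : Nonempty ((univ.filter (fun v => y v = j) : Finset V) ↪ Fin k) := by
      apply Function.Embedding.nonempty_of_card_le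
      rw [Fintype.card_coe, Fintype.card_fin]; exact h j
    obtain ⟨f⟩ := this
    exact ⟨f, f.injective⟩
  choose f hf using h1
  refine ⟨fun v => f (y v) ⟨v, by simp⟩, ?_⟩
  intro u v huv hr
  have key : ∀ j (hj : y v = j), f j ⟨v, by simp [hj]⟩ = f (y v) ⟨v, by simp⟩ := by
    rintro j rfl; rfl
  have := key (y u) huv.symm
  simp only at hr
  rw [← this] at hr
  have := hf _ hr
  simpa using this

end

end RTF


namespace RTF
open Finset
open scoped Classical

noncomputable section

section count
variable {M V ι : Type} [Fintype M] [LinearOrder M] [Fintype V] {q : ℕ}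

/-- number of elements of `T` adjacent to `w` -/
def dT (z : V → M) (a : M × M → Fin q) (T : Finset V) (w : M) : ℕ :=
  (T.filter (fun u => (FG a).Adj w (z u))).card

lemma dT_le (z : V → M) (a : M × M → Fin q) (k : ℕ) (ρ : V → Fin k)
    (hρ : ∀ u v, z u = z v → ρ u = ρ v → u = v) (T : Finset V) (w : M) :
    dT z a T w ≤ ∑ j, dd a ((T.filter (fun u => ρ u = j)).image z) w := by
  unfold dT
  rw [card_eq_sum_card_fiberwise (f := ρ) (t := univ) (fun _ _ => by simp)]
  refine sum_le_sum fun j _ => ?_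
  unfold dd
  rw [← card_image_of_injOn (f := z)]
  · apply card_le_card
    intro y hy
    obtain ⟨u, hu, rfl⟩ := mem_image.1 hy
    simp only [mem_filter] at hu
    rw [mem_filter]
    refine ⟨mem_image_of_mem _ (mem_filter.2 ⟨hu.1.1, hu.2⟩), hu.1.2.1.symm, hu.1.2.2.1⟩
  · intro u hu v hv h
    simp only [coe_filter, mem_filter, Set.mem_ofPred_eq] at hu hv
    exact hρ u v h (hu.2.trans hv.2.symm)

lemma killed_bound (s b κ : ℕ) (hs : 0 < s) (hb : 0 < b) (hκ : κ = 2 ^ 20 * s * b)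
    (z : V → M) (a : M × M → Fin q) (ha : Good s b a) (ρ : V → Fin (8 * b))
    (hρ : ∀ u v, z u = z v → ρ u = ρ v → u = v) (T : Finset V) (hT : T.card = κ) :
    ∑ w, (dT z a T w : ℝ) ^ 2 ≤ (κ:ℝ) ^ 2 / 8 := by
  have hsR : (0:ℝ) < s := by exact_mod_cast hs
  have hbR : (0:ℝ) < b := by exact_mod_cast hb
  have hκR : (κ:ℝ) = 2 ^ 20 * s * b := by rw [hκ]; push_cast; ring
  obtain ⟨Y, hYd⟩ : ∃ Y : Fin (8 * b) → Finset M, Y = fun j => (T.filter (fun u => ρ u = j)).image z := ⟨_, rfl⟩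
  have hYc : ∀ j, (Y j).card ≤ (T.filter (fun u => ρ u = j)).card := fun j => by
    rw [hYd]; exact card_image_le
  have hYκ : ∀ j, (Y j).card ≤ 2 ^ 20 * s * b := fun j => by
    rw [← hκ, ← hT]; exact (hYc j).trans (card_filter_le _ _)
  have hsum : ∑ j, ((Y j).card : ℝ) ≤ κ := by
    have h1 : ∑ j, (Y j).card ≤ κ := by
      rw [← hT, card_eq_sum_card_fiberwise (f := ρ) (t := univ) (fun _ _ => by simp)]
      exact sum_le_sum fun j _ => hYc j
    exact_mod_cast h1
  obtain ⟨c, hcd⟩ : ∃ c : Fin (8 * b) → ℝ, c = fun j => ((Y j).card : ℝ) + 2 ^ 17 * s := ⟨_, rfl⟩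
  have hc0 : ∀ j, 0 < c j := fun j => by rw [hcd]; positivity
  have hC : ∑ j, c j ≤ 2 * κ := by
    rw [hcd, sum_add_distrib]
    simp only [sum_const, card_univ, Fintype.card_fin, nsmul_eq_mul]
    push_cast
    rw [hκR] at hsum ⊢
    linarith
  have hne : Nonempty (Fin (8 * b)) := ⟨⟨0, by omega⟩⟩
  have hC0 : 0 < ∑ j, c j := sum_pos (fun j _ => hc0 j) univ_nonempty
  have h1 : ∀ w, (dT z a T w : ℝ) ^ 2 ≤ (∑ j, c j) * ∑ j, (dd a (Y j) w : ℝ) ^ 2 / c j := by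
    intro w
    have h2 : (dT z a T w : ℝ) ≤ ∑ j, (dd a (Y j) w : ℝ) := by
      have := dT_le z a (8 * b) ρ hρ T w
      rw [hYd]
      exact_mod_cast this
    have h3 := Finset.sq_sum_div_le_sum_sq_div univ (fun j => (dd a (Y j) w : ℝ)) (g := c) (fun j _ => hc0 j)
    rw [div_le_iff₀ hC0] at h3
    refine le_trans ?_ (h3.trans (mul_comm _ _).le)
    gcongr
  calc ∑ w, (dT z a T w : ℝ) ^ 2 ≤ ∑ w, (∑ j, c j) * ∑ j, (dd a (Y j) w : ℝ) ^ 2 / c j :=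
        sum_le_sum fun w _ => h1 w
    _ = (∑ j, c j) * ∑ j, (∑ w, (dd a (Y j) w : ℝ) ^ 2) / c j := by
        rw [← mul_sum, sum_comm]
        congr 1
        exact sum_congr rfl fun j _ => (sum_div _ _ _).symm
    _ ≤ (∑ j, c j) * ∑ j, c j / 32 := by
        refine mul_le_mul_of_nonneg_left (sum_le_sum fun j _ => ?_) hC0.le
        rw [div_le_iff₀ (hc0 j)]
        have := ha.2 (Y j) (hYκ j)
        refine this.trans (le_of_eq ?_)
        rw [hcd]; ring
    _ = (∑ j, c j) ^ 2 / 32 := by rw [← sum_div]; ring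
    _ ≤ (2 * κ) ^ 2 / 32 := by gcongr
    _ = _ := by ring

/-- surviving ordered pairs -/
def surv (z : V → M) (a : M × M → Fin q) (c : V → ι) (T : Finset V) : Finset (V × V) :=
  (T ×ˢ T).filter (fun p => c p.1 ≠ c p.2 ∧ ¬ ∃ w, (FG a).Adj (z p.1) w ∧ (FG a).Adj w (z p.2))

lemma card_surv (s b κ : ℕ) (hs : 0 < s) (hb : 0 < b) (hκ : κ = 2 ^ 20 * s * b)
    (z : V → M) (a : M × M → Fin q) (ha : Good s b a) (ρ : V → Fin (8 * b))
    (hρ : ∀ u v, z u = z v → ρ u = ρ v → u = v)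
    (c : V → ι) (hc : ∀ v, (univ.filter (fun u => c u = c v)).card ≤ 64 * s * b)
    (T : Finset V) (hT : T.card = κ) :
    κ ^ 2 ≤ 2 * (surv z a c T).card := by
  have hκR : (κ:ℝ) = 2 ^ 20 * s * b := by rw [hκ]; push_cast; ring
  have h1 : T ×ˢ T ⊆ surv z a c T ∪ ((T.biUnion fun v => (univ.filter (fun u => c u = c v)) ×ˢ {v}) ∪
      univ.biUnion fun w => (T.filter (fun u => (FG a).Adj w (z u))) ×ˢ (T.filter (fun u => (FG a).Adj w (z u)))) := by
    rintro ⟨u, v⟩ huv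
    rw [mem_product] at huv
    simp only [surv, mem_union, mem_filter, mem_product, mem_biUnion, mem_univ, true_and, mem_singleton]
    by_cases hcc : c u = c v
    · exact Or.inr (Or.inl ⟨v, huv.2, hcc, rfl⟩)
    by_cases hw : ∃ w, (FG a).Adj (z u) w ∧ (FG a).Adj w (z v)
    · obtain ⟨w, hw1, hw2⟩ := hw
      exact Or.inr (Or.inr ⟨w, ⟨huv.1, hw1.symm⟩, huv.2, hw2⟩)
    · exact Or.inl ⟨huv, hcc, hw⟩
  have h2 := (card_le_card h1).trans ((card_union_le _ _).trans (Nat.add_le_add_left (card_union_le _ _) _))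
  rw [card_product, hT] at h2
  have h3 : (T.biUnion fun v => (univ.filter (fun u => c u = c v)) ×ˢ {v}).card ≤ κ * (64 * s * b) := by
    rw [← hT]
    refine card_biUnion_le_card_mul _ _ _ fun v _ => ?_
    rw [card_product, card_singleton, mul_one]
    exact hc v
  have h4 : (univ.biUnion fun w => (T.filter (fun u => (FG a).Adj w (z u))) ×ˢ
      (T.filter (fun u => (FG a).Adj w (z u)))).card ≤ ∑ w, dT z a T w ^ 2 := by
    refine card_biUnion_le.trans (sum_le_sum fun w _ => ?_)
    rw [card_product, sq]; rfl
  have h5 := killed_bound s b κ hs hb hκ z a ha ρ hρ T hT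
  have h6 : ((∑ w, dT z a T w ^ 2 : ℕ) : ℝ) ≤ (κ:ℝ) ^ 2 / 8 := by push_cast; exact h5
  have h7 : κ * κ ≤ (surv z a c T).card + (κ * (64 * s * b) + ∑ w, dT z a T w ^ 2) := by
    omega
  have h8 : (κ:ℝ) * κ ≤ (surv z a c T).card + (κ * (64 * s * b) + ((∑ w, dT z a T w ^ 2 : ℕ) : ℝ)) := by
    exact_mod_cast h7
  have h9 : (64 * s * b : ℝ) ≤ κ / 8 := by
    rw [hκR]
    have : (0:ℝ) ≤ s * b := by positivity
    nlinarith
  have h10 : (κ:ℝ) * (64 * s * b) ≤ κ * (κ / 8) := by gcongr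
  have h11 : (κ:ℝ) ^ 2 ≤ 2 * (surv z a c T).card := by nlinarith
  exact_mod_cast h11

/-- the bad event: some set `T` all of whose first-colour edges are killed -/
def Bd (z1 z2 : V → M) (c : V → ι) (κ : ℕ) (a1 a2 : M × M → Fin q) : Prop :=
  ∃ T ∈ powersetCard κ (univ : Finset V), Set.InjOn z1 T ∧ ∀ u ∈ T, ∀ v ∈ T, c u ≠ c v →
    (FG a1).Adj (z1 u) (z1 v) → ∃ w, (FG a2).Adj (z2 u) w ∧ (FG a2).Adj w (z2 v)

lemma Pr_Bd (s b κ : ℕ) (hs : 0 < s) (hb : 0 < b) (hκ : κ = 2 ^ 20 * s * b)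
    (hM : Fintype.card M = s ^ 2) (hq : q = 512 * s) (hV : Fintype.card V ≤ 2 ^ b)
    (z1 z2 : V → M) (a2 : M × M → Fin q) (ha : Good s b a2) (ρ : V → Fin (8 * b))
    (hρ : ∀ u v, z2 u = z2 v → ρ u = ρ v → u = v)
    (c : V → ι) (hc : ∀ v, (univ.filter (fun u => c u = c v)).card ≤ 64 * s * b) :
    Pr (fun a1 : M × M → Fin q => Bd z1 z2 c κ a1 a2) ≤ 1 / 8 := by
  have hκ0 : 0 < κ := by rw [hκ]; positivity
  unfold Bd
  have h1 : ∀ T ∈ powersetCard κ (univ : Finset V), Pr (fun a1 : M × M → Fin q =>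
      Set.InjOn z1 T ∧ ∀ u ∈ T, ∀ v ∈ T, c u ≠ c v →
      (FG a1).Adj (z1 u) (z1 v) → ∃ w, (FG a2).Adj (z2 u) w ∧ (FG a2).Adj w (z2 v)) ≤
      2 * (1 / 2) ^ (8 * (32 * b * κ)) := by
    intro T hT
    have hTc : T.card = κ := (mem_powersetCard.1 hT).2
    by_cases hinj : Set.InjOn z1 T
    swap
    · refine (Pr_mono (Q := fun _ => False) fun a h => hinj h.1).trans ?_
      simp [Pr]
    obtain ⟨Q, hQd⟩ : ∃ Q : Finset (M × M), Q = (surv z2 a2 c T).image (fun p => ed (z1 p.1) (z1 p.2)) := ⟨_, rfl⟩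
    have hsub : ∀ p ∈ surv z2 a2 c T, p.1 ∈ T ∧ p.2 ∈ T ∧ c p.1 ≠ c p.2 ∧
        ¬ ∃ w, (FG a2).Adj (z2 p.1) w ∧ (FG a2).Adj w (z2 p.2) := by
      intro p hp
      simp only [surv, mem_filter, mem_product] at hp
      exact ⟨hp.1.1, hp.1.2, hp.2.1, hp.2.2⟩
    have hQX : Q ⊆ T.image z1 ×ˢ T.image z1 := by
      intro e he
      rw [hQd] at he
      obtain ⟨p, hp, rfl⟩ := mem_image.1 he
      obtain ⟨hp1, hp2, -⟩ := hsub p hp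
      have m1 := mem_image_of_mem z1 hp1
      have m2 := mem_image_of_mem z1 hp2
      rw [mem_product]
      unfold ed
      rcases le_total (z1 p.1) (z1 p.2) with h | h
      · simp only [min_eq_left h, max_eq_right h]; exact ⟨m1, m2⟩
      · simp only [min_eq_right h, max_eq_left h]; exact ⟨m2, m1⟩
    have hQ2 : (surv z2 a2 c T).card ≤ 2 * Q.card := by
      refine card_le_mul_card_image_of_maps_to (f := fun p : V × V => ed (z1 p.1) (z1 p.2))
        (fun p hp => by rw [hQd]; exact mem_image_of_mem _ hp) 2 ?_
      intro e he
      rw [hQd] at he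
      obtain ⟨p, hp, rfl⟩ := mem_image.1 he
      obtain ⟨hp1, hp2, -⟩ := hsub p hp
      have : (surv z2 a2 c T).filter (fun x => ed (z1 x.1) (z1 x.2) = ed (z1 p.1) (z1 p.2)) ⊆
          {p, (p.2, p.1)} := by
        intro x hx
        rw [mem_filter] at hx
        obtain ⟨hx1, hx2, -⟩ := hsub x hx.1
        have := (ed_eq_iff _ _ _ _).1 hx.2
        rw [mem_insert, mem_singleton]
        rcases this with ⟨h, h'⟩ | ⟨h, h'⟩
        · left; exact Prod.ext (hinj hx1 hp1 h) (hinj hx2 hp2 h')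
        · right; exact Prod.ext (hinj hx1 hp2 h) (hinj hx2 hp1 h')
      exact (card_le_card this).trans card_le_two
    have hQ : κ ^ 2 ≤ 4 * Q.card := by
      have := card_surv s b κ hs hb hκ z2 a2 ha ρ hρ c hc T hTc
      omega
    refine le_trans (Pr_mono ?_) (Pr_main s b κ hs hb hM hκ hq (T.image z1)
      (card_image_le.trans hTc.le) Q hQX hQ)
    rintro a1 ⟨-, h⟩ e he h0
    by_contra hr
    rw [hQd] at he
    obtain ⟨p, hp, rfl⟩ := mem_image.1 he
    obtain ⟨hp1, hp2, hpc, hpw⟩ := hsub p hp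
    exact hpw (h _ hp1 _ hp2 hpc ⟨fun hz => hpc (by rw [hinj hp1 hp2 hz]), h0, hr⟩)
  refine (Pr_biUnion_le _ _ _ h1).trans ?_
  have h2 : (((powersetCard κ (univ : Finset V)).card : ℕ) : ℝ) ≤ 2 ^ (b * κ) := by
    rw [card_powersetCard, card_univ, pow_mul]
    have : (Fintype.card V).choose κ ≤ (2 ^ b) ^ κ := (Nat.choose_le_pow _ _).trans (Nat.pow_le_pow_left hV _)
    exact_mod_cast this
  have hN : 1 ≤ b * κ := Nat.mul_pos hb hκ0
  have e1 : 8 * (32 * b * κ) = 256 * (b * κ) := by ring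
  rw [e1]
  calc _ ≤ (2:ℝ) ^ (b * κ) * (2 * (1 / 2) ^ (256 * (b * κ))) := by gcongr
    _ = 2 * (2 * (1 / 2) ^ 256) ^ (b * κ) := by rw [mul_pow, ← pow_mul]; ring
    _ ≤ 2 * (2 * (1 / 2) ^ 256) ^ 1 := by
      gcongr 2 * ?_
      exact pow_le_pow_of_le_one (by norm_num) (by norm_num) hN
    _ ≤ _ := by norm_num

end count

end

end RTF


namespace RTF
open Finset
open scoped Classical

noncomputable section

section core
variable {M V ι : Type} [Fintype M] [LinearOrder M] [Fintype V] {q : ℕ}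

lemma exists_inj_sub (z : V → M) (S : Finset V) (κ : ℕ) (h : κ ≤ (S.image z).card) :
    ∃ T ⊆ S, T.card = κ ∧ Set.InjOn z T := by
  obtain ⟨X, hX, hXc⟩ := exists_subset_card_eq h
  have h1 : ∀ m : X, ∃ v, v ∈ S ∧ z v = m := fun m => by
    simpa using mem_image.1 (hX m.2)
  choose g hg1 hg2 using h1
  have hginj : Function.Injective g := fun m m' hm => Subtype.ext (by rw [← hg2 m, ← hg2 m', hm])
  refine ⟨univ.image g, ?_, ?_, ?_⟩
  · intro v hv
    obtain ⟨m, -, rfl⟩ := mem_image.1 hv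
    exact hg1 m
  · rw [card_image_of_injective _ hginj, card_univ, Fintype.card_coe, hXc]
  · intro u hu v hv huv
    obtain ⟨m, -, rfl⟩ := mem_image.1 (mem_coe.1 hu)
    obtain ⟨m', -, rfl⟩ := mem_image.1 (mem_coe.1 hv)
    rw [hg2, hg2] at huv
    rw [Subtype.ext huv]

/-- the two-coloured graph -/
def GG (x y : V → M) (c : V → ι) (a1 a2 : M × M → Fin q) : SimpleGraph V where
  Adj u v := c u ≠ c v ∧
    (((FG a1).Adj (x u) (x v) ∧ ¬ ∃ w, (FG a2).Adj (y u) w ∧ (FG a2).Adj w (y v)) ∨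
     ((FG a2).Adj (y u) (y v) ∧ ¬ ∃ w, (FG a1).Adj (x u) w ∧ (FG a1).Adj w (x v)))
  symm := ⟨by
    rintro u v ⟨h0, h⟩
    refine ⟨h0.symm, ?_⟩
    rcases h with ⟨h1, h2⟩ | ⟨h1, h2⟩
    · exact Or.inl ⟨h1.symm, fun ⟨w, hw, hw'⟩ => h2 ⟨w, hw'.symm, hw.symm⟩⟩
    · exact Or.inr ⟨h1.symm, fun ⟨w, hw, hw'⟩ => h2 ⟨w, hw'.symm, hw.symm⟩⟩⟩
  loopless := ⟨fun u h => h.1 rfl⟩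

lemma GG_tf (x y : V → M) (c : V → ι) (a1 a2 : M × M → Fin q) : TF (GG x y c a1 a2) := by
  rintro u v w ⟨-, huv⟩ ⟨-, hvw⟩ ⟨-, huw⟩
  rcases huv with ⟨h1, h1'⟩ | ⟨h1, h1'⟩ <;> rcases hvw with ⟨h2, h2'⟩ | ⟨h2, h2'⟩ <;>
    rcases huw with ⟨h3, h3'⟩ | ⟨h3, h3'⟩
  · exact FG_tf a1 _ _ _ h1 h2 h3
  · exact h3' ⟨_, h1, h2⟩
  · exact h2' ⟨_, h1.symm, h3⟩
  · exact h1' ⟨_, h3, h2.symm⟩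
  · exact h1' ⟨_, h3, h2.symm⟩
  · exact h2' ⟨_, h1.symm, h3⟩
  · exact h3' ⟨_, h1, h2⟩
  · exact FG_tf a2 _ _ _ h1 h2 h3

lemma deg_fib (z : V → M) (a : M × M → Fin q) (k s : ℕ)
    (hz : ∀ j, (univ.filter (fun v => z v = j)).card ≤ k) (ha : ∀ w, dd a univ w ≤ s) (i : M) :
    (univ.filter (fun u => (FG a).Adj i (z u))).card ≤ k * s := by
  have h1 : (univ.filter (fun u => (FG a).Adj i (z u))).card ≤
      k * (univ.filter (fun j : M => j ≠ i ∧ (a (ed i j)).val = 0)).card := by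
    refine card_le_mul_card_image_of_maps_to (f := z) ?_ k ?_
    · intro u hu
      rw [mem_filter] at hu ⊢
      exact ⟨mem_univ _, hu.2.1.symm, hu.2.2.1⟩
    · intro j _
      exact (card_le_card (filter_subset_filter _ (filter_subset _ _))).trans (hz j)
  exact h1.trans (Nat.mul_le_mul_left _ (ha i))

lemma core_gen (s b κ : ℕ) (hs : 64 ≤ s) (hb : 0 < b) (hκ : κ = 2 ^ 20 * s * b)
    (hM : Fintype.card M = s ^ 2) (hsb : s ^ 2 * b ≤ 2 ^ b)
    (H1 : (b:ℝ) / 100 * Real.exp (b / 10) ≤ s)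
    (H2 : 2048 * b * Real.exp (b / 50) + b ≤ (b:ℝ) / 100 * Real.exp (b / 20))
    (H3 : 4 * 2 ^ (3 * b) * (2 ^ 20 * b) ^ 16 ≤ s ^ 16)
    (c : M × Fin b → ι) (hc : ∀ v, (univ.filter (fun u => c u = c v)).card ≤ 64 * s * b) :
    ∃ G : SimpleGraph (M × Fin b), TF G ∧ (∀ u v, G.Adj u v → c u ≠ c v) ∧
      (∀ v, (univ.filter (fun w => G.Adj v w)).card ≤ 9 * s * b) ∧
      ∀ S, Indep G S → S.card ≤ 16 * κ := by
  have hs0 : 0 < s := by omega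
  have hsb' : s ^ 2 ≤ 2 ^ b := le_trans (Nat.le_mul_of_pos_right _ hb) hsb
  have hV : Fintype.card (M × Fin b) = s ^ 2 * b := by simp [hM]
  obtain ⟨x, hxd⟩ : ∃ x : M × Fin b → M, x = Prod.fst := ⟨_, rfl⟩
  have hx : ∀ X : Finset M, (univ.filter (fun v => x v ∈ X)).card ≤ b * X.card := by
    intro X
    have : univ.filter (fun v : M × Fin b => x v ∈ X) ⊆ X ×ˢ univ := by
      intro v hv
      rw [hxd] at hv
      simpa using hv
    refine (card_le_card this).trans ?_
    rw [card_product, card_univ, Fintype.card_fin, mul_comm]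
  have hx1 : ∀ j, (univ.filter (fun v => x v = j)).card ≤ b := by
    intro j
    have := hx {j}
    simpa using this
  obtain ⟨y, hy1', hy2'⟩ := exists_y (V := M × Fin b) (M := M) s b κ hs0 hb hM hV hsb' hκ H3 x
    (fun X => by convert hx X)
  have hy1 : ∀ j, (univ.filter (fun v => y v = j)).card ≤ 8 * b := fun j => by convert hy1' j
  have hy2 : ∀ S : Finset (M × Fin b), 16 * κ ≤ S.card → κ < (S.image x).card ∨ κ < (S.image y).card :=
    fun S hS => by convert hy2' S hS
  obtain ⟨ρy, hρy⟩ := exists_label y (8 * b) hy1'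
  have hx8 : ∀ j, (univ.filter (fun v => x v = j)).card ≤ 8 * b := fun j =>
    (hx1 j).trans (show b ≤ 8 * b by omega)
  obtain ⟨ρx, hρx⟩ := exists_label x (8 * b) (fun j => by convert hx8 j)
  obtain ⟨q, hq⟩ : ∃ q, q = 512 * s := ⟨_, rfl⟩
  have hne : Nonempty (Fin q) := ⟨⟨0, by omega⟩⟩
  have hG := Pr_good (M := M) (q := q) s b hs hb hM hq hsb' H1 H2
  have hB1 : Pr (fun ω : (M × M → Fin q) × (M × M → Fin q) => Good s b ω.2 ∧ Bd x y c κ ω.1 ω.2) ≤ 1 / 8 := by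
    refine Pr_prod_left _ _ (by norm_num) fun a2 => ?_
    by_cases h : Good s b a2
    · refine le_trans (Pr_mono fun a1 h => h.2) ?_
      exact Pr_Bd s b κ hs0 hb hκ hM hq (hV.le.trans hsb) x y a2 h ρy hρy c hc
    · refine (Pr_mono (Q := fun _ => False) fun a h' => h h'.1).trans ?_
      simp [Pr]
  have hB2 : Pr (fun ω : (M × M → Fin q) × (M × M → Fin q) => Good s b ω.1 ∧ Bd y x c κ ω.2 ω.1) ≤ 1 / 8 := by
    refine Pr_prod_right _ _ (by norm_num) fun a1 => ?_
    by_cases h : Good s b a1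
    · refine le_trans (Pr_mono fun a2 h => h.2) ?_
      exact Pr_Bd s b κ hs0 hb hκ hM hq (hV.le.trans hsb) y x a1 h ρx hρx c hc
    · refine (Pr_mono (Q := fun _ => False) fun a h' => h h'.1).trans ?_
      simp [Pr]
  have hG1 : Pr (fun ω : (M × M → Fin q) × (M × M → Fin q) => ¬ Good s b ω.1) ≤ 1 / 8 :=
    Pr_prod_left _ _ (by norm_num) fun a2 => hG
  have hG2 : Pr (fun ω : (M × M → Fin q) × (M × M → Fin q) => ¬ Good s b ω.2) ≤ 1 / 8 :=
    Pr_prod_right _ _ (by norm_num) fun a1 => hG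
  have hall := Pr_le_of_or (fun _ h => h) (Pr_le_of_or (fun _ h => h) hG1 hG2)
    (Pr_le_of_or (fun _ h => h) hB1 hB2)
  obtain ⟨⟨a1, a2⟩, hω⟩ := exists_not_of_Pr (hall.trans_lt (by norm_num))
  simp only [not_or, not_and, not_not] at hω
  obtain ⟨⟨g1, g2⟩, n1, n2⟩ := hω
  have n1 := n1 g2
  have n2 := n2 g1
  refine ⟨GG x y c a1 a2, GG_tf _ _ _ _ _, fun u v h => h.1, fun v => ?_, fun S hS => ?_⟩
  · have h1 : univ.filter (fun w => (GG x y c a1 a2).Adj v w) ⊆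
        univ.filter (fun u => (FG a1).Adj (x v) (x u)) ∪ univ.filter (fun u => (FG a2).Adj (y v) (y u)) := by
      intro u hu
      rw [mem_filter] at hu
      rw [mem_union, mem_filter, mem_filter]
      rcases hu.2.2 with h | h
      · exact Or.inl ⟨mem_univ _, h.1⟩
      · exact Or.inr ⟨mem_univ _, h.1⟩
    have h2 := (card_le_card h1).trans (card_union_le _ _)
    have h3 := deg_fib x a1 b s hx1 g1.1 (x v)
    have h4 := deg_fib y a2 (8 * b) s hy1 g2.1 (y v)
    calc _ ≤ b * s + 8 * b * s := h2.trans (add_le_add h3 h4)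
      _ = _ := by ring
  · by_contra hcon
    push Not at hcon
    rcases hy2 S hcon.le with h | h
    · obtain ⟨T, hTS, hTc, hTi⟩ := exists_inj_sub x S κ h.le
      apply n1
      refine ⟨T, mem_powersetCard.2 ⟨subset_univ _, hTc⟩, hTi, fun u hu v hv hcuv hadj => ?_⟩
      by_contra hw
      exact hS u (hTS hu) v (hTS hv) (fun e => hcuv (by rw [e])) ⟨hcuv, Or.inl ⟨hadj, hw⟩⟩
    · obtain ⟨T, hTS, hTc, hTi⟩ := exists_inj_sub y S κ h.le
      apply n2
      refine ⟨T, mem_powersetCard.2 ⟨subset_univ _, hTc⟩, hTi, fun u hu v hv hcuv hadj => ?_⟩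
      by_contra hw
      exact hS u (hTS hu) v (hTS hv) (fun e => hcuv (by rw [e])) ⟨hcuv, Or.inr ⟨hadj, hw⟩⟩

end core

end

end RTF


namespace RTF
open Finset
open scoped Classical

noncomputable section

lemma ev_pow (k : ℕ) (r C : ℝ) (hr : 1 < r) (hC : 0 < C) :
    ∃ b0 : ℕ, ∀ b : ℕ, b0 ≤ b → C * (b:ℝ) ^ k ≤ r ^ b := by
  have h := tendsto_pow_const_div_const_pow_of_one_lt k hr
  have h2 := h.eventually (gt_mem_nhds (show (0:ℝ) < 1 / C by positivity))
  obtain ⟨b0, hb0⟩ := Filter.eventually_atTop.1 h2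
  refine ⟨b0, fun b hb => ?_⟩
  have h3 := hb0 b hb
  have hp : (0:ℝ) < r ^ b := by positivity
  rw [div_lt_iff₀ hp] at h3
  have : C * (b:ℝ) ^ k < C * (1 / C * r ^ b) := by gcongr
  have e : C * (1 / C * r ^ b) = r ^ b := by field_simp
  linarith

lemma num_H1 : ∃ b0 : ℕ, ∀ b : ℕ, b0 ≤ b → ∀ s : ℕ, 2 ^ b ≤ s ^ 3 →
    (b:ℝ) / 100 * Real.exp (b / 10) ≤ s := by
  obtain ⟨b0, h⟩ := ev_pow 3 (5 / 4) 1 (by norm_num) (by norm_num)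
  refine ⟨b0, fun b hb s hs => ?_⟩
  have h1 := h b hb
  have hs' : (2:ℝ) ^ b ≤ (s:ℝ) ^ 3 := by exact_mod_cast hs
  have h2 : ((b:ℝ) / 100 * Real.exp (b / 10)) ^ 3 ≤ (s:ℝ) ^ 3 := by
    refine le_trans ?_ hs'
    rw [mul_pow, ← Real.exp_nat_mul]
    have e1 : Real.exp (((3:ℕ):ℝ) * (b / 10)) = Real.exp (3 / 10) ^ b := by
      rw [← Real.exp_nat_mul]; congr 1; push_cast; ring
    have e2 : Real.exp (3 / 10) ≤ 8 / 5 := by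
      have := Real.abs_exp_sub_one_sub_id_le (x := (3/10:ℝ)) (by rw [abs_of_nonneg] <;> norm_num)
      have := (abs_le.1 this).2
      norm_num at this ⊢
      linarith
    rw [e1]
    calc ((b:ℝ) / 100) ^ 3 * Real.exp (3 / 10) ^ b ≤ (5 / 4) ^ b * (8 / 5) ^ b := by
          gcongr
          refine le_trans ?_ h1
          rw [one_mul]
          gcongr
          have : (0:ℝ) ≤ b := by positivity
          linarith
      _ = 2 ^ b := by rw [← mul_pow]; norm_num
  exact (pow_le_pow_iff_left₀ (by positivity) (by positivity) (by norm_num)).1 h2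

lemma num_H2 (b : ℕ) (hb : 10000 ≤ b) :
    2048 * b * Real.exp (b / 50) + b ≤ (b:ℝ) / 100 * Real.exp (b / 20) := by
  have hbR : (10000:ℝ) ≤ b := by exact_mod_cast hb
  obtain ⟨u, hu⟩ : ∃ u, u = Real.exp ((b:ℝ) / 100) := ⟨_, rfl⟩
  have h1 : (100:ℝ) ≤ u := by
    have := Real.add_one_le_exp ((b:ℝ) / 100)
    rw [hu]; linarith
  have e1 : Real.exp ((b:ℝ) / 50) = u ^ 2 := by
    rw [hu, ← Real.exp_nat_mul]; congr 1; push_cast; ring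
  have e2 : Real.exp ((b:ℝ) / 20) = u ^ 5 := by
    rw [hu, ← Real.exp_nat_mul]; congr 1; push_cast; ring
  rw [e1, e2]
  have h3 : (100:ℝ) ^ 3 ≤ u ^ 3 := by gcongr
  have h4 : (1:ℝ) ≤ u ^ 2 := by nlinarith
  have h5 : 2048 * u ^ 2 + 1 ≤ u ^ 5 / 100 := by
    have : u ^ 5 = u ^ 3 * u ^ 2 := by ring
    nlinarith
  calc 2048 * (b:ℝ) * u ^ 2 + b = b * (2048 * u ^ 2 + 1) := by ring
    _ ≤ b * (u ^ 5 / 100) := by gcongr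
    _ = _ := by ring

lemma num_H3 : ∃ b0 : ℕ, ∀ b : ℕ, b0 ≤ b → ∀ s : ℕ, 2 ^ b ≤ s ^ 3 →
    4 * 2 ^ (3 * b) * (2 ^ 20 * b) ^ 16 ≤ s ^ 16 := by
  obtain ⟨b0, h⟩ := ev_pow 48 (2 ^ 7) (64 * (2 ^ 20) ^ 48) (by norm_num) (by positivity)
  refine ⟨b0, fun b hb s hs => ?_⟩
  have h1 := h b hb
  have h1' : 64 * (2 ^ 20) ^ 48 * b ^ 48 ≤ (2 ^ 7) ^ b := by exact_mod_cast h1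
  have h2 : (4 * 2 ^ (3 * b) * (2 ^ 20 * b) ^ 16) ^ 3 ≤ (s ^ 16) ^ 3 := by
    calc (4 * 2 ^ (3 * b) * (2 ^ 20 * b) ^ 16) ^ 3
        = (2 ^ b) ^ 9 * (64 * (2 ^ 20) ^ 48 * b ^ 48) := by
          rw [mul_pow, mul_pow, ← pow_mul, ← pow_mul, mul_pow, ← pow_mul 2 b 9]
          rw [show 3 * b * 3 = b * 9 by ring]
          ring
      _ ≤ (2 ^ b) ^ 9 * (2 ^ 7) ^ b := by gcongr
      _ = (2 ^ b) ^ 16 := by rw [← pow_mul, ← pow_mul, ← pow_mul, ← pow_add]; congr 1; ring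
      _ ≤ (s ^ 3) ^ 16 := by gcongr
      _ = _ := by rw [← pow_mul, ← pow_mul]
  exact (Nat.pow_le_pow_iff_left (by norm_num)).1 h2

lemma card_fst {V A B : Type} [Fintype V] [Fintype A] [Fintype B] (E : V ≃ A × B) (i : A) :
    (univ.filter (fun u => (E u).1 = i)).card = Fintype.card B := by
  have : univ.filter (fun u => (E u).1 = i) =
      (({i} : Finset A) ×ˢ (univ : Finset B)).map E.symm.toEmbedding := by
    ext u
    simp only [mem_filter, mem_univ, true_and, mem_map_equiv, Equiv.symm_symm, mem_product,
      mem_singleton, and_true]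
  rw [this, card_map, card_product, card_singleton, one_mul, card_univ]

/-- combining everything for admissible parameters -/
lemma assemble (t b n : ℕ) (ht : 0 < t) (hb : 10000 ≤ b)
    (hsb : (64 * t) ^ 2 * b ≤ 2 ^ b)
    (H1 : (b:ℝ) / 100 * Real.exp (b / 10) ≤ ((64 * t : ℕ) : ℝ))
    (H3 : 4 * 2 ^ (3 * b) * (2 ^ 20 * b) ^ 16 ≤ (64 * t) ^ 16)
    (hn : 2 * ((64 * t) ^ 2 * b) + 8 * (9 * (64 * t) * b) + 1 ≤ n) :
    Res (Fin n) (2 * (9 * (64 * t) * b))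
      (16 * (2 ^ 20 * (64 * t) * b) + 16 * (2 ^ 20 * (64 * t) * b) + (n - 2 * ((64 * t) ^ 2 * b))) := by
  obtain ⟨s, hs⟩ : ∃ s, s = 64 * t := ⟨_, rfl⟩
  have hcard : s ^ 2 = t * (4096 * t) := by rw [hs]; ring
  rw [← hs] at hsb H1 H3 hn ⊢
  have hs0 : 0 < s := by omega
  have hb0 : 0 < b := by omega
  let e : Fin (s ^ 2) ≃ Fin t × Fin (4096 * t) := (finCongr hcard).trans finProdFinEquiv.symm
  let E : Fin (s ^ 2) × Fin b ≃ Fin t × (Fin (4096 * t) × Fin b) :=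
    (e.prodCongr (Equiv.refl _)).trans (Equiv.prodAssoc _ _ _)
  have hfib : ∀ v, (univ.filter (fun u => (E u).1 = (E v).1)).card = 64 * s * b := by
    intro v
    have h : (univ.filter (fun u => (E u).1 = (E v).1)).card = Fintype.card (Fin (4096 * t) × Fin b) := by
      convert card_fst E (E v).1
    rw [h]
    simp only [Fintype.card_prod, Fintype.card_fin]
    rw [hs]; ring
  obtain ⟨G, hG1, hG2, hG3, hG4⟩ := core_gen (M := Fin (s ^ 2)) (ι := Fin t) s b (2 ^ 20 * s * b) (by omega) hb0 rfl
    (by simp) hsb H1 (num_H2 b hb) H3 (fun v => (E v).1) (fun v => le_of_eq (by convert hfib v))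
  have hR := Res_double G (fun v => (E v).1) (9 * s * b) (16 * (2 ^ 20 * s * b)) hG1 hG2
    (fun v => by convert hG3 v) (fun v => by
      have h1 : (univ.filter (fun u => (E u).1 = (E v).1)).card = 64 * s * b := hfib v
      have h2 : 0 < s * b := by positivity
      have h3 : 6 * (9 * s * b) < 64 * s * b := by nlinarith
      rw [← h1] at h3
      convert h3) hG4
  have hC := Res_circ (n - 2 * (s ^ 2 * b)) (9 * s * b) (by omega)
  refine Res_equiv (Fintype.equivOfCardEq ?_) (Res_sum hR hC)
  simp only [Fintype.card_sum, Fintype.card_prod, Fintype.card_fin]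
  omega

lemma large_n : ∃ n0 : ℕ, ∀ n : ℕ, n0 ≤ n → ∃ r a s b : ℕ, Res (Fin n) r a ∧ a ≤ 2 ^ 26 * (s * b) ∧
    2 * (s ^ 2 * b) ≤ n ∧ 2 ^ b ≤ 2 * n := by
  obtain ⟨b1, h1⟩ := num_H1
  obtain ⟨b3, h3⟩ := num_H3
  obtain ⟨b4, h4⟩ := ev_pow 3 2 (22 ^ 3) (by norm_num) (by norm_num)
  obtain ⟨b5, h5⟩ := ev_pow 1 2 30000 (by norm_num) (by norm_num)
  obtain ⟨B, hBd⟩ : ∃ B, B = b1 + b3 + b4 + b5 + 10000 := ⟨_, rfl⟩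
  refine ⟨2 ^ B, fun n hn => ?_⟩
  have hn0 : n ≠ 0 := by
    have : 0 < 2 ^ B := by positivity
    omega
  obtain ⟨b, hbd⟩ : ∃ b, b = Nat.log 2 n + 1 := ⟨_, rfl⟩
  have hb1 : n < 2 ^ b := by rw [hbd]; exact Nat.lt_pow_succ_log_self (by norm_num) n
  have hb2 : 2 ^ b ≤ 2 * n := by
    rw [hbd, pow_succ]
    have := Nat.pow_log_le_self 2 hn0
    omega
  have hbB : B ≤ b := by
    have := (Nat.pow_lt_pow_iff_right (show 1 < 2 by norm_num)).1 (hn.trans_lt hb1)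
    exact this.le
  have hbpos : 0 < b := by omega
  have h5' : 30000 * b ≤ 2 ^ b := by
    have := h5 b (by omega)
    rw [pow_one] at this
    exact_mod_cast this
  have h4' : 22 ^ 3 * b ^ 3 ≤ 2 ^ b := by
    have := h4 b (by omega)
    exact_mod_cast this
  obtain ⟨P, hP⟩ : ∃ P : ℕ → Prop, P = fun t => 2 * ((64 * t) ^ 2 * b) + 8 * (9 * (64 * t) * b) + 1 ≤ n := ⟨_, rfl⟩
  obtain ⟨t, htd⟩ : ∃ t, t = Nat.findGreatest P n := ⟨_, rfl⟩
  have hP0 : P 0 := by rw [hP]; simp; omega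
  have hPt : P t := by
    rw [htd]; exact Nat.findGreatest_spec (Nat.zero_le n) hP0
  have hPt1 : ¬ P (t + 1) := by
    by_cases hle : t + 1 ≤ n
    · exact Nat.findGreatest_is_greatest (by omega) hle
    · rw [hP]
      push Not at hle ⊢
      nlinarith [Nat.zero_le ((64 * (t+1)) ^ 2 * b), Nat.mul_le_mul_left (64 * (t + 1)) hbpos]
  rw [hP] at hPt hPt1
  simp only [not_le] at hPt hPt1
  have ht0 : 0 < t := by
    rcases Nat.eq_zero_or_pos t with h | h
    · rw [h] at hPt1
      norm_num at hPt1
      omega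
    · exact h
  have htb : b ≤ t * b := Nat.le_mul_of_pos_left _ ht0
  have httb : t * b ≤ t ^ 2 * b := by
    rw [sq, mul_assoc]; exact Nat.le_mul_of_pos_left _ ht0
  have hsq : n < 8192 * (t ^ 2 * b) + 20992 * (t * b) + 12800 * b + 1 := by
    refine hPt1.trans_le (le_of_eq ?_); ring
  have hsq1 : (64 * t) ^ 2 * b = 4096 * (t ^ 2 * b) := by ring
  have h2b : 2 ^ b ≤ 22 * b * (64 * t) ^ 2 := by
    have e : 22 * b * (64 * t) ^ 2 = 90112 * (t ^ 2 * b) := by ring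
    rw [e]; omega
  have hs22 : 22 * b ≤ 64 * t := by
    have : (22 * b) * (22 * b) ^ 2 ≤ (22 * b) * (64 * t) ^ 2 := by
      calc (22 * b) * (22 * b) ^ 2 = 22 ^ 3 * b ^ 3 := by ring
        _ ≤ _ := h4'.trans h2b
    have := Nat.le_of_mul_le_mul_left this (by omega)
    exact (Nat.pow_le_pow_iff_left (by norm_num)).1 this
  have hcube : 2 ^ b ≤ (64 * t) ^ 3 := by
    calc 2 ^ b ≤ 22 * b * (64 * t) ^ 2 := h2b
      _ ≤ (64 * t) * (64 * t) ^ 2 := Nat.mul_le_mul_right _ hs22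
      _ = _ := by ring
  have hRes := assemble t b n ht0 (by omega) (by omega) (h1 b (by omega) _ hcube) (h3 b (by omega) _ hcube) hPt
  refine ⟨_, _, 64 * t, b, hRes, ?_, by omega, hb2⟩
  have e1 : 2 ^ 20 * (64 * t) * b = 67108864 * (t * b) := by ring
  have e2 : 2 ^ 26 * (64 * t * b) = 4294967296 * (t * b) := by ring
  rw [e1, e2, hsq1]
  omega

lemma real_bound (n s b : ℕ) (hn : 2 ≤ n) (h1 : 2 * (s ^ 2 * b) ≤ n) (h2 : 2 ^ b ≤ 2 * n) :
    ((s * b : ℕ) : ℝ) ≤ 2 * Real.sqrt (n * Real.log n) := by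
  have hnR : (2:ℝ) ≤ n := by exact_mod_cast hn
  have hl2 : (0.69:ℝ) < Real.log 2 := by linarith [Real.log_two_gt_d9]
  have hln : Real.log 2 ≤ Real.log n := Real.log_le_log (by norm_num) hnR
  have hb : (b:ℝ) ≤ 4 * Real.log n := by
    have h3 : ((2:ℝ) ^ b) ≤ 2 * n := by exact_mod_cast h2
    have h4 := Real.log_le_log (by positivity) h3
    rw [Real.log_pow, Real.log_mul (by norm_num) (by positivity)] at h4
    have hb0 : (0:ℝ) ≤ b := by positivity
    nlinarith
  have h1' : 2 * ((s:ℝ) ^ 2 * b) ≤ n := by exact_mod_cast h1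
  have h5 : ((s * b : ℕ) : ℝ) ^ 2 ≤ 4 * (n * Real.log n) := by
    push_cast
    calc ((s:ℝ) * b) ^ 2 = ((s:ℝ) ^ 2 * b) * b := by ring
      _ ≤ n * (4 * Real.log n) := by
        gcongr
        have : 0 ≤ (s:ℝ) ^ 2 * b := by positivity
        linarith
      _ = _ := by ring
  have h6 := Real.le_sqrt_of_sq_le h5
  rw [Real.sqrt_mul (by norm_num)] at h6
  have : Real.sqrt 4 = 2 := by
    rw [show (4:ℝ) = 2 ^ 2 by norm_num]; exact Real.sqrt_sq (by norm_num)
  rwa [this] at h6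

lemma main_ex : ∃ C : ℝ, 0 < C ∧ ∀ n : ℕ, 2 ≤ n → ∃ r a : ℕ, Res (Fin n) r a ∧
    (a : ℝ) ≤ C * Real.sqrt (n * Real.log n) := by
  obtain ⟨n0, h⟩ := large_n
  refine ⟨2 ^ 27 + n0, by positivity, fun n hn => ?_⟩
  have hsq : (1:ℝ) ≤ Real.sqrt (n * Real.log n) := by
    apply Real.le_sqrt_of_sq_le
    have hnR : (2:ℝ) ≤ n := by exact_mod_cast hn
    have hl2 : (0.69:ℝ) < Real.log 2 := by linarith [Real.log_two_gt_d9]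
    have hln : Real.log 2 ≤ Real.log n := Real.log_le_log (by norm_num) hnR
    nlinarith
  by_cases hn0 : n0 ≤ n
  · obtain ⟨r, a, s, b, hR, ha, h1, h2⟩ := h n hn0
    refine ⟨r, a, hR, ?_⟩
    have h3 := real_bound n s b hn h1 h2
    have h4 : (a:ℝ) ≤ 2 ^ 26 * ((s * b : ℕ) : ℝ) := by exact_mod_cast ha
    have h5 : (0:ℝ) ≤ n0 * Real.sqrt (n * Real.log n) := by positivity
    nlinarith
  · refine ⟨0, n, ⟨⊥, fun a b c hab => by simp at hab, fun v => by simp, fun S _ => ?_⟩, ?_⟩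
    · simpa using card_le_univ S
    · have h1 : (n:ℝ) ≤ n0 := by exact_mod_cast (not_le.1 hn0).le
      have h2 : (0:ℝ) ≤ n0 := by positivity
      nlinarith

end

end RTF

theorem regular_triangle_free_ramsey :
    ∃ C : ℝ, 0 < C ∧ ∀ n : ℕ, 2 ≤ n →
      ∃ (r : ℕ) (G : SimpleGraph (Fin n)) (_ : DecidableRel G.Adj),
        G.CliqueFree 3 ∧ G.IsRegularOfDegree r ∧
        ∀ s : Finset (Fin n), (∀ u ∈ s, ∀ v ∈ s, u ≠ v → ¬ G.Adj u v) →
          (s.card : ℝ) ≤ C * Real.sqrt (n * Real.log n) := by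
  obtain ⟨C, hC, h⟩ := RTF.main_ex
  refine ⟨C, hC, fun n hn => ?_⟩
  obtain ⟨r, a, ⟨G, h1, h2, h3⟩, ha⟩ := h n hn
  refine ⟨r, G, Classical.decRel _, ?_, ?_, ?_⟩
  · intro t ht
    rw [SimpleGraph.is3Clique_iff] at ht
    obtain ⟨x, y, z, hxy, hxz, hyz, -⟩ := ht
    exact h1 x y z hxy hyz hxz
  · intro v
    rw [← h2 v, ← SimpleGraph.card_neighborFinset_eq_degree]
    congr 1
    ext w
    simp
  · intro s hs
    have : (s.card : ℝ) ≤ a := by exact_mod_cast h3 s hs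
    exact this.trans ha
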